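/- As an identity of power series in q (valid for |q|<1): ∑_{n≥0} (M_ω(1,5,5n+2) − M_ω(4,5,5n+2)) q^n = (4q/5)·(q,q^4;q^5)_∞^2 (q^5;q^5)_∞^3 / (q^2,q^3;q^5)_∞^4 + (2/5)·(q^2,q^3;q^5)_∞ (q^5;q^5)_∞^3 / (q,q^4;q^5)_∞^3 − (2/5)·(q^5;q^5)_∞ / (q^2,q^3;q^5)_∞. -/

import Mathlib

/-!
Common definitions: for a partition `π` of `n`,
`numParts` is the number of parts, `largestPart` the largest part,
`omegaOnes` the number of parts equal to 1, `rank` and `crank` the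
Dyson rank and Andrews–Garvan crank.  `NT m j n` is the total number of
parts over partitions of `n` with rank ≡ m (mod j), and `Mw m j n` is
the total number of ones over partitions of `n` with crank ≡ m (mod j).
`poch a q = (a; q)_∞ = ∏_{n ≥ 0} (1 - a qⁿ)`.
-/

namespace Beck

/-- number of parts of a partition -/
def numParts {n : ℕ} (π : n.Partition) : ℕ := Multiset.card π.parts

/-- largest part of a partition (0 for the empty partition) -/
def largestPart {n : ℕ} (π : n.Partition) : ℕ := π.parts.sup

/-- number of ones in a partition -/
def omegaOnes {n : ℕ} (π : n.Partition) : ℕ := π.parts.count 1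

/-- number of parts strictly larger than the number of ones -/
def muParts {n : ℕ} (π : n.Partition) : ℕ :=
  Multiset.card (π.parts.filter fun x => omegaOnes π < x)

/-- Dyson's rank: largest part minus number of parts -/
def rank {n : ℕ} (π : n.Partition) : ℤ :=
  (largestPart π : ℤ) - (numParts π : ℤ)

/-- the Andrews–Garvan crank -/
def crank {n : ℕ} (π : n.Partition) : ℤ :=
  if omegaOnes π = 0 then (largestPart π : ℤ)
  else (muParts π : ℤ) - (omegaOnes π : ℤ)

/-- `NT m j n`: total number of parts in partitions of `n` with rank ≡ m (mod j) -/
def NT (m j n : ℕ) : ℤ :=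
  ∑ π : n.Partition,
    if rank π % (j : ℤ) = (m : ℤ) % (j : ℤ) then (numParts π : ℤ) else 0

/-- `Mw m j n`: total number of ones in partitions of `n` with crank ≡ m (mod j) -/
def Mw (m j n : ℕ) : ℤ :=
  ∑ π : n.Partition,
    if crank π % (j : ℤ) = (m : ℤ) % (j : ℤ) then (omegaOnes π : ℤ) else 0

/-- `(a; q)_∞ = ∏_{n ≥ 0} (1 - a qⁿ)` -/
noncomputable def poch (a q : ℂ) : ℂ := ∏' n : ℕ, (1 - a * q ^ n)

section

open Filter Topology

lemma hasSum_of_eq {ι M : Type*} [AddCommMonoid M] [TopologicalSpace M] {f g : ι → M} {a b : M}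
    (hg : HasSum g b)
    (hfg : ∀ i, f i = g i) (hab : a = b) : HasSum f a := by
  rwa [funext hfg, hab]

lemma norm_mul_pow_lt_one {q : ℂ} (hq : ‖q‖ < 1) {a : ℂ} (ha : ‖a‖ < 1) (n : ℕ) :
    ‖a * q ^ n‖ < 1 := by
  rw [norm_mul, norm_pow]
  exact (mul_le_of_le_one_right (norm_nonneg a) (pow_le_one₀ (norm_nonneg q) hq.le)).trans_lt ha

lemma one_sub_ne_zero_of_norm_lt_one {a : ℂ} (ha : ‖a‖ < 1) : 1 - a ≠ 0 := by
  rintro h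
  rw [← sub_eq_zero.mp h] at ha
  simp at ha

lemma summable_norm_mul_pow {q : ℂ} (hq : ‖q‖ < 1) (a : ℂ) :
    Summable fun n : ℕ => ‖-(a * q ^ n)‖ := by
  simpa using (summable_geometric_of_lt_one (norm_nonneg q) hq).mul_left ‖a‖

lemma multipliable_poch {q : ℂ} (hq : ‖q‖ < 1) (a : ℂ) :
    Multipliable fun n : ℕ => 1 - a * q ^ n := by
  simpa [sub_eq_add_neg] using multipliable_one_add_of_summable (summable_norm_mul_pow hq a)

lemma tendsto_prod_poch {q : ℂ} (hq : ‖q‖ < 1) (a : ℂ) :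
    Tendsto (fun n => ∏ i ∈ Finset.range n, (1 - a * q ^ i)) atTop (𝓝 (poch a q)) :=
  (multipliable_poch hq a).hasProd.tendsto_prod_nat

lemma poch_ne_zero {q : ℂ} (hq : ‖q‖ < 1) {a : ℂ} (ha : ∀ n, 1 - a * q ^ n ≠ 0) :
    poch a q ≠ 0 := by
  have := tprod_one_add_ne_zero_of_summable (f := fun n : ℕ => -(a * q ^ n))
    (by simpa [sub_eq_add_neg] using ha) (summable_norm_mul_pow hq a)
  simpa [poch, sub_eq_add_neg] using this

lemma poch_ne_zero_of_norm_lt_one {q : ℂ} (hq : ‖q‖ < 1) {a : ℂ} (ha : ‖a‖ < 1) :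
    poch a q ≠ 0 :=
  poch_ne_zero hq fun n => one_sub_ne_zero_of_norm_lt_one (norm_mul_pow_lt_one hq ha n)

lemma poch_eq_prod_mul {q : ℂ} (hq : ‖q‖ < 1) (a : ℂ) (k : ℕ) :
    poch a q = (∏ i ∈ Finset.range k, (1 - a * q ^ i)) * poch (a * q ^ k) q := by
  have h := tendsto_prod_poch hq a
  have h2 := (tendsto_prod_poch hq (a * q ^ k)).const_mul
    (∏ i ∈ Finset.range k, (1 - a * q ^ i))
  refine tendsto_nhds_unique ((tendsto_add_atTop_iff_nat k).mpr h) (h2.congr fun n => ?_)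
  rw [add_comm n k, Finset.prod_range_add]
  simp [pow_add, mul_assoc]

lemma poch_succ {q : ℂ} (hq : ‖q‖ < 1) (a : ℂ) :
    poch a q = (1 - a) * poch (a * q) q := by
  simpa using poch_eq_prod_mul hq a 1

lemma poch_zero (q : ℂ) : poch 0 q = 1 := by simp [poch]

lemma differentiable_poch {q : ℂ} (hq : ‖q‖ < 1) :
    Differentiable ℂ fun a => poch a q := by
  intro a
  have hs : Summable fun n : ℕ => (‖a‖ + 1) * ‖q‖ ^ n :=
    (summable_geometric_of_lt_one (norm_nonneg q) hq).mul_left _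
  have h := hs.hasProdLocallyUniformlyOn_nat_one_add (K := Metric.ball (0 : ℂ) (‖a‖ + 1))
    (f := fun n x => -(x * q ^ n)) Metric.isOpen_ball
    (.of_forall fun n x hx => by
      rw [norm_neg, norm_mul, norm_pow]
      have : ‖x‖ < ‖a‖ + 1 := by simpa using hx
      gcongr) (fun n => by fun_prop)
  have hd := h.differentiableOn
    (.of_forall fun _ => by simpa [Finset.prod_fn] using
      DifferentiableOn.finsetProd (fun _ _ => by fun_prop)) Metric.isOpen_ball
  have := hd.differentiableAt (Metric.isOpen_ball.mem_nhds (x := a) (by simp))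
  simpa [poch, sub_eq_add_neg] using this

/-- The coefficient `(a; q)_k / (q; q)_k` of the `q`-binomial series. -/
noncomputable def qbinomCoeff (a q : ℂ) (k : ℕ) : ℂ :=
  ∏ j ∈ Finset.range k, ((1 - a * q ^ j) / (1 - q * q ^ j))

lemma exists_norm_qbinomCoeff_le {q : ℂ} (hq : ‖q‖ < 1) (a : ℂ) :
    ∃ C : ℝ, 0 ≤ C ∧ ∀ k, ‖qbinomCoeff a q k‖ ≤ C := by
  have h : Tendsto (qbinomCoeff a q) atTop (𝓝 (poch a q / poch q q)) := by
    refine ((tendsto_prod_poch hq a).div (tendsto_prod_poch hq q)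
      (poch_ne_zero_of_norm_lt_one hq hq)).congr fun n => ?_
    simp [qbinomCoeff, Finset.prod_div_distrib]
  obtain ⟨C, hC⟩ := h.norm.bddAbove_range
  exact ⟨C, (norm_nonneg _).trans (hC ⟨0, rfl⟩), fun k => hC ⟨k, rfl⟩⟩

lemma summable_norm_qbinom {q : ℂ} (hq : ‖q‖ < 1) (a : ℂ) {t : ℂ} (ht : ‖t‖ < 1) :
    Summable fun k : ℕ => ‖qbinomCoeff a q k * t ^ k‖ := by
  obtain ⟨C, -, hC⟩ := exists_norm_qbinomCoeff_le hq a
  refine Summable.of_nonneg_of_le (fun _ => norm_nonneg _) (fun k => ?_)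
    ((summable_geometric_of_lt_one (norm_nonneg t) ht).mul_left C)
  rw [norm_mul, norm_pow]
  gcongr
  exact hC k

lemma qbinom_bound {q : ℂ} (hq : ‖q‖ < 1) (a : ℂ) {r : ℝ} (hr : r < 1) (hr0 : 0 ≤ r) :
    ∃ u : ℕ → ℝ, Summable u ∧
      ∀ k, ∀ t ∈ Metric.ball (0 : ℂ) r, ‖qbinomCoeff a q k * t ^ k‖ ≤ u k := by
  obtain ⟨C, hC0, hC⟩ := exists_norm_qbinomCoeff_le hq a
  refine ⟨_, (summable_geometric_of_lt_one hr0 hr).mul_left C, fun k t ht => ?_⟩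
  rw [norm_mul, norm_pow]
  have : ‖t‖ ≤ r := by simpa using (Metric.mem_ball.mp ht).le
  gcongr
  exact hC k

lemma qbinom_functional {q : ℂ} (hq : ‖q‖ < 1) (a : ℂ) {t : ℂ} (ht : ‖t‖ < 1) :
    (1 - t) * ∑' k, qbinomCoeff a q k * t ^ k
      = (1 - a * t) * ∑' k, qbinomCoeff a q k * (t * q) ^ k := by
  have htq : ‖t * q‖ < 1 := by simpa using norm_mul_pow_lt_one hq ht 1
  have h1 := (summable_norm_qbinom hq a ht).of_norm
  have h2 := (summable_norm_qbinom hq a htq).of_norm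
  have key : ∑' k, (qbinomCoeff a q k * t ^ k - qbinomCoeff a q k * (t * q) ^ k)
      = ∑' k, (t * (qbinomCoeff a q k * t ^ k) - a * t * (qbinomCoeff a q k * (t * q) ^ k)) := by
    rw [(h1.sub h2).tsum_eq_zero_add]
    simp only [pow_zero, sub_self, zero_add]
    refine tsum_congr fun k => ?_
    have hne : 1 - q * q ^ k ≠ 0 := one_sub_ne_zero_of_norm_lt_one (norm_mul_pow_lt_one hq hq k)
    have hc : qbinomCoeff a q (k + 1) * (1 - q * q ^ k) = qbinomCoeff a q k * (1 - a * q ^ k) := by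
      rw [qbinomCoeff, Finset.prod_range_succ, ← qbinomCoeff, mul_assoc, div_mul_cancel₀ _ hne]
    linear_combination t ^ (k + 1) * hc
  rw [h1.tsum_sub h2, (h1.mul_left t).tsum_sub (h2.mul_left (a * t)), tsum_mul_left,
    tsum_mul_left] at key
  linear_combination key

/-- The `q`-binomial theorem. -/
lemma tsum_qbinom {q : ℂ} (hq : ‖q‖ < 1) (a : ℂ) {t : ℂ} (ht : ‖t‖ < 1) :
    ∑' k, qbinomCoeff a q k * t ^ k = poch (a * t) q / poch t q := by
  set A : ℂ → ℂ := fun t => ∑' k, qbinomCoeff a q k * t ^ k with hA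
  have hcont : ContinuousAt A 0 := by
    obtain ⟨u, hu, hle⟩ := qbinom_bound hq a (r := 1 / 2) (by norm_num) (by norm_num)
    exact ((Complex.differentiableOn_tsum_of_summable_norm hu (fun k => by fun_prop)
      Metric.isOpen_ball hle).differentiableAt
        (Metric.isOpen_ball.mem_nhds (by simp))).continuousAt
  have hA0 : A 0 = 1 := by
    simp only [hA]
    rw [tsum_eq_single 0 (fun k hk => by simp [hk])]
    simp [qbinomCoeff]
  have iter : ∀ n : ℕ, (∏ i ∈ Finset.range n, (1 - t * q ^ i)) * A t
      = (∏ i ∈ Finset.range n, (1 - a * t * q ^ i)) * A (t * q ^ n) := by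
    intro n
    induction n with
    | zero => simp
    | succ n ih =>
      have := qbinom_functional hq a (norm_mul_pow_lt_one hq ht n)
      rw [Finset.prod_range_succ, Finset.prod_range_succ, mul_right_comm, ih, pow_succ,
        ← mul_assoc t]
      simp only [hA]
      linear_combination (∏ i ∈ Finset.range n, (1 - a * t * q ^ i)) * this
  have hlim : Tendsto (fun n : ℕ => t * q ^ n) atTop (𝓝 0) := by
    simpa using (tendsto_pow_atTop_nhds_zero_of_norm_lt_one hq).const_mul t
  have h1 := (tendsto_prod_poch hq t).mul_const (A t)
  have h2 := (tendsto_prod_poch hq (a * t)).mul (hcont.tendsto.comp hlim)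
  rw [hA0, mul_one] at h2
  have := tendsto_nhds_unique h1 (h2.congr fun n => (iter n).symm)
  rw [eq_div_iff (poch_ne_zero_of_norm_lt_one hq ht), mul_comm]
  exact this

lemma hasSum_mul_qbinom {q : ℂ} (hq : ‖q‖ < 1) (a : ℂ) {t : ℂ} (ht : ‖t‖ < 1) :
    HasSum (fun k : ℕ => k * (qbinomCoeff a q k * t ^ k))
      (t * deriv (fun t => poch (a * t) q / poch t q) t) := by
  obtain ⟨r, htr, hr⟩ := exists_between ht
  obtain ⟨u, hu, hle⟩ := qbinom_bound hq a hr ((norm_nonneg t).trans htr.le)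
  have htm : t ∈ Metric.ball (0 : ℂ) r := by simpa using htr
  have h := Complex.hasSum_deriv_of_summable_norm hu (fun k => by fun_prop)
    Metric.isOpen_ball hle htm
  have he : (fun w => ∑' k, qbinomCoeff a q k * w ^ k) =ᶠ[𝓝 t]
      fun t => poch (a * t) q / poch t q := by
    filter_upwards [Metric.isOpen_ball.mem_nhds htm] with w hw
    exact tsum_qbinom hq a ((by simpa using hw : ‖w‖ < r).trans hr)
  rw [he.deriv_eq] at h
  refine hasSum_of_eq (h.mul_left t) (fun k => ?_) rfl
  cases k with
  | zero => simp
  | succ k => simp; ring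

section

/-- The triangular numbers `n(n-1)/2`, indexed by the integers. -/
def tri (n : ℤ) : ℤ := n * (n - 1) / 2

lemma two_mul_tri (n : ℤ) : 2 * tri n = n * (n - 1) :=
  Int.mul_ediv_cancel' (Int.even_mul_pred_self n).two_dvd

lemma tri_succ (n : ℤ) : tri (n + 1) = tri n + n := by
  have h1 := two_mul_tri n
  have h2 := two_mul_tri (n + 1)
  linarith

/-- The theta series `∑ (-1)ⁿ q^{n(n-1)/2} zⁿ` over the integers. -/
noncomputable def theta (q z : ℂ) : ℂ := ∑' n : ℤ, q ^ tri n * (-z) ^ n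

/-- The Euler derivative `z d/dz` of the theta series. -/
noncomputable def thetaD (q z : ℂ) : ℂ := z * deriv (theta q) z

lemma summable_tri_nat {r : ℝ} (hr0 : 0 < r) (hr : r < 1) {w : ℝ} (hw : 0 < w) :
    Summable fun n : ℕ => r ^ tri n * w ^ (n : ℤ) := by
  refine summable_of_ratio_test_tendsto_lt_one (l := 0) (by norm_num)
    (.of_forall fun n => by positivity) ?_
  have : Tendsto (fun n : ℕ => r ^ n * w) atTop (𝓝 0) := by
    simpa using (tendsto_pow_atTop_nhds_zero_of_lt_one hr0.le hr).mul_const w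
  refine this.congr fun n => ?_
  rw [Real.norm_of_nonneg (by positivity), Real.norm_of_nonneg (by positivity), Nat.cast_succ,
    tri_succ, zpow_add₀ hr0.ne', zpow_add₀ hw.ne', zpow_natCast r n]
  field_simp

lemma summable_tri {r : ℝ} (hr0 : 0 < r) (hr : r < 1) {w : ℝ} (hw : 0 < w) :
    Summable fun n : ℤ => r ^ tri n * w ^ n := by
  refine Summable.of_nat_of_neg (summable_tri_nat hr0 hr hw) ?_
  refine (summable_tri_nat hr0 hr (w := r / w) (by positivity)).congr fun n => ?_
  have h : tri (-(n : ℤ)) = tri n + n := by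
    have h1 := two_mul_tri n
    have h2 := two_mul_tri (-(n : ℤ))
    linarith
  rw [h, zpow_add₀ hr0.ne', div_zpow, zpow_neg]
  field_simp

lemma norm_theta_term (q z : ℂ) (n : ℤ) :
    ‖q ^ tri n * (-z) ^ n‖ = ‖q‖ ^ tri n * ‖z‖ ^ n := by
  simp [norm_zpow]

/-- Reflection of the theta series. -/
lemma theta_reflect {q : ℂ} (hq0 : q ≠ 0) (z : ℂ) : theta q (q / z) = theta q z := by
  rw [theta, theta, ← (Equiv.neg ℤ).tsum_eq]
  refine tsum_congr fun n => ?_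
  have h : tri (-n) = tri n + n := by
    have h1 := two_mul_tri n
    have h2 := two_mul_tri (-n)
    linarith
  rw [Equiv.neg_apply, h, zpow_add₀ hq0, ← div_neg, div_zpow, zpow_neg, zpow_neg]
  field_simp

lemma theta_mul_q {q : ℂ} (hq0 : q ≠ 0) {z : ℂ} (hz : z ≠ 0) : z * theta q (q * z) = -theta q z := by
  rw [theta, theta, ← tsum_mul_left, ← tsum_neg, ← (Equiv.addRight (1 : ℤ)).tsum_eq
    (fun n : ℤ => -(q ^ tri n * (-z) ^ n))]
  refine tsum_congr fun n => ?_
  rw [Equiv.coe_addRight, tri_succ, zpow_add₀ hq0, zpow_add₀ (neg_ne_zero.mpr hz),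
    zpow_one, neg_mul_eq_mul_neg q z, mul_zpow]
  ring

lemma theta_inv {q : ℂ} (hq0 : q ≠ 0) {z : ℂ} (hz : z ≠ 0) : z * theta q (1 / z) = -theta q z := by
  have h := theta_mul_q hq0 (one_div_ne_zero hz)
  rw [mul_one_div, theta_reflect hq0 z] at h
  field_simp at h
  linear_combination h

section
variable {q : ℂ} (hq0 : q ≠ 0) (hq : ‖q‖ < 1)
include hq0 hq

lemma summable_norm_theta {z : ℂ} (hz : z ≠ 0) :
    Summable fun n : ℤ => ‖q ^ tri n * (-z) ^ n‖ := by
  simp_rw [norm_theta_term]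
  exact summable_tri (norm_pos_iff.mpr hq0) hq (norm_pos_iff.mpr hz)

lemma hasSum_theta {z : ℂ} (hz : z ≠ 0) :
    HasSum (fun n : ℤ => q ^ tri n * (-z) ^ n) (theta q z) :=
  (summable_norm_theta hq0 hq hz).of_norm.hasSum

lemma theta_bound {z : ℂ} (hz : z ≠ 0) : ∃ (U : Set ℂ) (u : ℤ → ℝ), IsOpen U ∧ z ∈ U ∧
    Summable u ∧ (∀ w ∈ U, w ≠ 0) ∧ ∀ n : ℤ, ∀ w ∈ U, ‖q ^ tri n * (-w) ^ n‖ ≤ u n := by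
  have hz' := norm_pos_iff.mpr hz
  have hq' := norm_pos_iff.mpr hq0
  refine ⟨{w | ‖z‖ / 2 < ‖w‖ ∧ ‖w‖ < 2 * ‖z‖}, _, ?_, ⟨by linarith, by linarith⟩,
    (summable_tri hq' hq (w := 2 * ‖z‖) (by positivity)).add
      (summable_tri hq' hq (w := ‖z‖ / 2) (by positivity)), ?_, ?_⟩
  · exact (isOpen_lt continuous_const continuous_norm).inter
      (isOpen_lt continuous_norm continuous_const)
  · rintro w ⟨hw, -⟩ rfl
    simp at hw
    linarith
  · rintro n w ⟨hw1, hw2⟩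
    have hw : 0 < ‖w‖ := by linarith
    rw [norm_theta_term, ← mul_add]
    gcongr
    rcases le_total 0 n with hn | hn
    · have := zpow_le_zpow_left₀ hn hw.le hw2.le
      have : 0 < (‖z‖ / 2) ^ n := by positivity
      linarith
    · have := zpow_le_zpow_left₀ (neg_nonneg.mpr hn) (by positivity) hw1.le
      rw [zpow_neg, zpow_neg, inv_le_inv₀ (by positivity) (by positivity)] at this
      have : 0 < (2 * ‖z‖) ^ n := by positivity
      linarith

lemma differentiableAt_theta {z : ℂ} (hz : z ≠ 0) : DifferentiableAt ℂ (theta q) z := by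
  obtain ⟨U, u, hU, hzU, hu, hU0, hle⟩ := theta_bound hq0 hq hz
  refine (Complex.differentiableOn_tsum_of_summable_norm hu (fun n w hw => ?_)
    hU hle).differentiableAt (hU.mem_nhds hzU)
  exact (((differentiableAt_zpow.mpr (.inl (neg_ne_zero.mpr (hU0 w hw)))).comp w
    differentiableAt_id.neg).const_mul _).differentiableWithinAt

lemma hasSum_thetaD {z : ℂ} (hz : z ≠ 0) :
    HasSum (fun n : ℤ => n * (q ^ tri n * (-z) ^ n)) (thetaD q z) := by
  obtain ⟨U, u, hU, hzU, hu, hU0, hle⟩ := theta_bound hq0 hq hz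
  have hd (n : ℤ) {w : ℂ} (hw : w ≠ 0) :
      HasDerivAt (fun w : ℂ => q ^ tri n * (-w) ^ n) (q ^ tri n * (n * (-w) ^ (n - 1) * -1)) w :=
    ((hasDerivAt_zpow n (-w) (.inl (neg_ne_zero.mpr hw))).comp w
      (hasDerivAt_id w).neg).const_mul _
  have h := Complex.hasSum_deriv_of_summable_norm hu
    (fun n w hw => (hd n (hU0 w hw)).differentiableAt.differentiableWithinAt) hU hle hzU
  refine hasSum_of_eq (h.mul_left z) (fun n => ?_) rfl
  rw [(hd n hz).deriv, zpow_sub_one₀ (neg_ne_zero.mpr hz)]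
  field_simp

lemma hasDerivAt_theta {z : ℂ} (hz : z ≠ 0) : HasDerivAt (theta q) (thetaD q z / z) z := by
  rw [thetaD, mul_div_cancel_left₀ _ hz]
  exact (differentiableAt_theta hq0 hq hz).hasDerivAt

lemma thetaD_mul_q {z : ℂ} (hz : z ≠ 0) :
    z * thetaD q (q * z) = theta q z - thetaD q z := by
  have h1 : HasDerivAt (fun z => z * theta q (q * z))
      (1 * theta q (q * z) + z * (thetaD q (q * z) / (q * z) * (q * 1))) z :=
    (hasDerivAt_id z).mul ((hasDerivAt_theta hq0 hq (mul_ne_zero hq0 hz)).comp z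
      ((hasDerivAt_id z).const_mul q))
  have h2 : HasDerivAt (fun z => z * theta q (q * z)) (-(thetaD q z / z)) z := by
    refine (hasDerivAt_theta hq0 hq hz).neg.congr_of_eventuallyEq ?_
    filter_upwards [isOpen_ne.mem_nhds hz] with w hw using theta_mul_q hq0 hw
  have h := h1.unique h2
  have h3 := theta_mul_q hq0 hz
  field_simp at h
  linear_combination h - h3

lemma thetaD_reflect {z : ℂ} (hz : z ≠ 0) : thetaD q (q / z) = -thetaD q z := by
  have hqz : q / z ≠ 0 := div_ne_zero hq0 hz
  have h1 : HasDerivAt (fun z => theta q (q / z))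
      (thetaD q (q / z) / (q / z) * ((0 * z - q * 1) / z ^ 2)) z :=
    (hasDerivAt_theta hq0 hq hqz).comp z
      ((hasDerivAt_const z q).div (hasDerivAt_id z) hz)
  have h2 : HasDerivAt (fun z => theta q (q / z)) (thetaD q z / z) z := by
    refine (hasDerivAt_theta hq0 hq hz).congr_of_eventuallyEq ?_
    filter_upwards [isOpen_ne.mem_nhds hz] with w hw using theta_reflect hq0 w
  have h := h1.unique h2
  field_simp at h
  refine mul_left_cancel₀ hq0 ?_
  linear_combination -h

lemma thetaD_inv {z : ℂ} (hz : z ≠ 0) :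
    z * thetaD q (1 / z) = thetaD q z - theta q z := by
  have h := thetaD_mul_q hq0 hq (one_div_ne_zero hz)
  rw [mul_one_div, thetaD_reflect hq0 hq hz] at h
  have h' := theta_inv hq0 hz
  field_simp at h
  linear_combination h' + h

end

/-- `1 / (q; q)_m`, extended by zero to negative `m`. -/
noncomputable def invPoch (q : ℂ) (m : ℤ) : ℂ :=
  if 0 ≤ m then (∏ i ∈ Finset.range m.toNat, (1 - q * q ^ i))⁻¹ else 0

lemma prod_one_sub_ne_zero {q : ℂ} (hq : ‖q‖ < 1) (n : ℕ) :
    ∏ i ∈ Finset.range n, (1 - q * q ^ i) ≠ 0 :=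
  Finset.prod_ne_zero_iff.mpr fun i _ =>
    one_sub_ne_zero_of_norm_lt_one (norm_mul_pow_lt_one hq hq i)

lemma invPoch_sub_one {q : ℂ} (hq : ‖q‖ < 1) (m : ℤ) :
    invPoch q (m - 1) = (1 - q ^ m) * invPoch q m := by
  rcases lt_trichotomy m 0 with hm | rfl | hm
  · rw [invPoch, invPoch, if_neg (by omega), if_neg (by omega), mul_zero]
  · simp [invPoch]
  · obtain ⟨k, rfl⟩ : ∃ k : ℕ, m = k + 1 := ⟨(m - 1).toNat, by omega⟩
    rw [invPoch, invPoch, if_pos (by omega), if_pos (by omega)]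
    have h1 : ((k : ℤ) + 1 - 1).toNat = k := by omega
    have h2 : ((k : ℤ) + 1).toNat = k + 1 := by omega
    have h3 : q ^ ((k : ℤ) + 1) = q * q ^ k := by
      rw [mul_comm, ← pow_succ]
      exact_mod_cast zpow_natCast q (k + 1)
    have h4 := prod_one_sub_ne_zero hq (k + 1)
    rw [Finset.prod_range_succ] at h4
    rw [h1, h2, h3, Finset.prod_range_succ, mul_inv, mul_comm, mul_assoc,
      inv_mul_cancel₀ (right_ne_zero_of_mul h4), mul_one]

lemma exists_norm_invPoch_le {q : ℂ} (hq : ‖q‖ < 1) :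
    ∃ C : ℝ, 0 ≤ C ∧ ∀ m, ‖invPoch q m‖ ≤ C := by
  have h := ((tendsto_prod_poch hq q).inv₀ (poch_ne_zero_of_norm_lt_one hq hq)).norm
  obtain ⟨C, hC⟩ := h.bddAbove_range
  have hC0 : 0 ≤ C := (norm_nonneg _).trans (hC ⟨0, rfl⟩)
  refine ⟨C, hC0, fun m => ?_⟩
  rw [invPoch]
  split_ifs
  · exact hC ⟨m.toNat, rfl⟩
  · simpa

lemma tendsto_invPoch {q : ℂ} (hq : ‖q‖ < 1) {f : ℕ → ℤ} (hf : Tendsto f atTop atTop) :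
    Tendsto (fun n => invPoch q (f n)) atTop (𝓝 (poch q q)⁻¹) := by
  have h := (tendsto_prod_poch hq q).inv₀ (poch_ne_zero_of_norm_lt_one hq hq)
  have hN : Tendsto (fun n => (f n).toNat) atTop atTop :=
    tendsto_atTop.mpr fun b => (tendsto_atTop.mp hf b).mono fun n hn => by omega
  refine (h.comp hN).congr' ?_
  filter_upwards [tendsto_atTop.mp hf 0] with n hn
  simp [invPoch, hn]

/-- A finite form of the Jacobi triple product identity. -/
lemma hasSum_finite_triple {q : ℂ} (hq0 : q ≠ 0) (hq : ‖q‖ < 1) {z : ℂ} (hz : z ≠ 0) (n : ℕ) :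
    HasSum (fun k : ℤ => (∏ i ∈ Finset.range (2 * n), (1 - q * q ^ i)) * invPoch q (n + k)
        * invPoch q (n - k) * (q ^ tri k * (-z) ^ k))
      ((∏ i ∈ Finset.range n, (1 - z * q ^ i)) * ∏ i ∈ Finset.range n, (1 - q / z * q ^ i)) := by
  induction n with
  | zero =>
    refine hasSum_of_eq (hasSum_single (0 : ℤ) fun k hk => ?_) (fun k => rfl) ?_
    · rcases lt_or_gt_of_ne hk with h | h
      · simp [invPoch, h]
      · simp [invPoch, h]
    · simp [invPoch, tri]
  | succ n ih =>
    have hm := (Equiv.subRight (1 : ℤ)).hasSum_iff.mpr ih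
    have hp := (Equiv.addRight (1 : ℤ)).hasSum_iff.mpr ih
    refine hasSum_of_eq (((ih.mul_left (1 + q ^ (2 * n + 1))).add
      (hm.mul_left (-(z * q ^ n)))).add (hp.mul_left (-(q ^ (n + 1) / z)))) (fun k => ?_) ?_
    · simp only [Function.comp, Equiv.coe_addRight, Equiv.subRight_apply]
      have e1 : tri k = tri (k - 1) + (k - 1) := by
        have := tri_succ (k - 1)
        rwa [sub_add_cancel] at this
      set A := invPoch q (n + 1 + k) with hA
      set B := invPoch q (n + 1 - k) with hB
      have a1 : invPoch q (n + k) = (1 - q ^ (n + 1 + k)) * A := by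
        rw [hA, ← invPoch_sub_one hq]; congr 1; ring
      have b1 : invPoch q (n - k) = (1 - q ^ (n + 1 - k)) * B := by
        rw [hB, ← invPoch_sub_one hq]; congr 1; ring
      have a2 : invPoch q (n + (k - 1)) = (1 - q ^ (n + k)) * ((1 - q ^ (n + 1 + k)) * A) := by
        rw [← a1, ← invPoch_sub_one hq]; congr 1; ring
      have b2 : invPoch q (n - (k + 1)) = (1 - q ^ (n - k)) * ((1 - q ^ (n + 1 - k)) * B) := by
        rw [← b1, ← invPoch_sub_one hq]; congr 1; ring
      have a3 : invPoch q (n + (k + 1)) = A := by rw [hA]; congr 1; ring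
      have b3 : invPoch q (n - (k - 1)) = B := by rw [hB]; congr 1; ring
      have a4 : invPoch q ((n + 1 : ℕ) + k) = A := by rw [hA]; push_cast; rfl
      have b4 : invPoch q ((n + 1 : ℕ) - k) = B := by rw [hB]; push_cast; rfl
      have hz' := neg_ne_zero.mpr hz
      have t1 : q ^ tri (k - 1) * q ^ (k : ℤ) = q ^ tri k * q := by
        rw [e1, ← zpow_add₀ hq0, ← zpow_add_one₀ hq0]; congr 1; ring
      have t1' : q ^ tri (k - 1) = q ^ tri k * q / q ^ k := by
        rw [← t1, mul_div_cancel_right₀ _ (zpow_ne_zero _ hq0)]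
      rw [a1, b1, a2, b2, a3, b3, a4, b4, tri_succ, t1', zpow_sub_one₀ hz', zpow_add_one₀ hz',
        zpow_add₀ hq0 (tri k), Nat.mul_succ, Finset.prod_range_add]
      have hk := zpow_ne_zero k hq0
      simp only [zpow_add₀ hq0, zpow_sub₀ hq0, zpow_natCast, zpow_one,
        Finset.prod_range_succ, Finset.prod_range_zero]
      set Q := q ^ n with hQ
      have p1 : q ^ (2 * n) = Q ^ 2 := by rw [hQ, ← pow_mul, mul_comm]
      simp only [pow_add, pow_zero, pow_one, p1]
      field_simp
      ring
    · rw [Finset.prod_range_succ, Finset.prod_range_succ, pow_succ, pow_succ, mul_comm 2 n, pow_mul]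
      field_simp
      ring

/-- The Jacobi triple product identity. -/
theorem theta_eq_poch {q : ℂ} (hq0 : q ≠ 0) (hq : ‖q‖ < 1) {z : ℂ} (hz : z ≠ 0) :
    theta q z = poch z q * poch (q / z) q * poch q q := by
  have hJ := poch_ne_zero_of_norm_lt_one hq hq
  obtain ⟨C, hC0, hC⟩ := exists_norm_invPoch_le hq
  obtain ⟨M, hM⟩ := (tendsto_prod_poch hq q).norm.bddAbove_range
  have hM0 : 0 ≤ M := (norm_nonneg _).trans (hM ⟨0, rfl⟩)
  have h2n : Tendsto (fun n : ℕ => 2 * n) atTop atTop :=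
    tendsto_atTop_mono (fun n => show n ≤ 2 * n by omega) tendsto_id
  have h1 := tendsto_tsum_of_dominated_convergence (𝓕 := atTop)
    (f := fun (n : ℕ) (k : ℤ) => (∏ i ∈ Finset.range (2 * n), (1 - q * q ^ i)) * invPoch q (n + k)
      * invPoch q (n - k) * (q ^ tri k * (-z) ^ k))
    (g := fun k : ℤ => poch q q * (poch q q)⁻¹ * (poch q q)⁻¹ * (q ^ tri k * (-z) ^ k))
    ((summable_norm_theta hq0 hq hz).mul_left (M * C * C))
    (fun k => by
      refine Tendsto.mul_const _ (Tendsto.mul (Tendsto.mul ?_ ?_) ?_)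
      · exact (tendsto_prod_poch hq q).comp h2n
      · exact tendsto_invPoch hq (tendsto_atTop_add_const_right _ k tendsto_natCast_atTop_atTop)
      · exact tendsto_invPoch hq (tendsto_atTop_add_const_right _ (-k) tendsto_natCast_atTop_atTop))
    (.of_forall fun n k => by
      rw [norm_mul, norm_mul, norm_mul]
      gcongr
      · exact hM ⟨2 * n, rfl⟩
      · exact hC _
      · exact hC _)
  simp_rw [(hasSum_finite_triple hq0 hq hz _).tsum_eq, tsum_mul_left] at h1
  have h2 := tendsto_nhds_unique h1
    ((tendsto_prod_poch hq z).mul (tendsto_prod_poch hq (q / z)))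
  rw [← theta] at h2
  rw [← h2]
  field_simp

end

section

section
variable {q : ℂ} (hq0 : q ≠ 0) (hq : ‖q‖ < 1)
include hq0 hq

lemma thetaD_one : thetaD q 1 = -poch q q ^ 3 := by
  have hd : DifferentiableAt ℂ (fun z => poch (z * q) q * poch (q / z) q * poch q q) 1 := by
    have h1 : DifferentiableAt ℂ (fun z : ℂ => q / z) 1 :=
      (differentiableAt_const q).div differentiableAt_id one_ne_zero
    exact (((differentiable_poch hq _).comp 1 (differentiableAt_id.mul_const q)).mul
      ((differentiable_poch hq _).comp 1 h1)).mul_const _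
  have h := ((hasDerivAt_id (1 : ℂ)).const_sub 1).mul hd.hasDerivAt
  have he : theta q =ᶠ[𝓝 1]
      fun z => (1 - z) * (poch (z * q) q * poch (q / z) q * poch q q) := by
    filter_upwards [isOpen_ne.mem_nhds one_ne_zero] with z hz
    rw [theta_eq_poch hq0 hq hz, poch_succ hq z]
    ring
  rw [thetaD, (h.congr_of_eventuallyEq he).deriv]
  simp
  ring

end

/-- The bijection splitting pairs of integers by the parity of their sum. -/
def paritySplit : (ℤ × ℤ) ⊕ (ℤ × ℤ) ≃ ℤ × ℤ where
  toFun := Sum.elim (fun p => (p.1 + p.2, p.1 - p.2)) fun p => (p.1 + p.2, p.1 + 1 - p.2)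
  invFun p := if (p.1 + p.2) % 2 = 0 then .inl ((p.1 + p.2) / 2, (p.1 - p.2) / 2)
    else .inr ((p.1 + p.2 - 1) / 2, (p.1 - p.2 + 1) / 2)
  left_inv := by
    rintro (⟨i, j⟩ | ⟨i, j⟩)
    · have h : (i + j + (i - j)) % 2 = 0 := by omega
      simp only [Sum.elim_inl, h, if_true]
      congr 2 <;> omega
    · have h : ¬ (i + j + (i + 1 - j)) % 2 = 0 := by omega
      simp only [Sum.elim_inr, h, if_false]
      congr 2 <;> omega
  right_inv := by
    rintro ⟨m, n⟩
    dsimp only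
    split_ifs with h
    · ext <;> simp <;> omega
    · ext <;> simp <;> omega

/-- The product `θ(xy) θ(x/y)` is a rank-two alternating form up to the factor `x`. -/
lemma exists_theta_mul_theta {q : ℂ} (hq0 : q ≠ 0) (hq : ‖q‖ < 1) :
    ∃ A B : ℂ → ℂ, ∀ x y : ℂ, x ≠ 0 → y ≠ 0 →
      theta q (x * y) * theta q (x / y) = A x * B y - x / y * (B x * A y) := by
  refine ⟨fun x => ∑' i : ℤ, q ^ (i * i - i) * x ^ (2 * i), fun y => ∑' j : ℤ, q ^ (j * j) * y ^ (2 * j),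
    fun x y hx hy => ?_⟩
  have hA {x : ℂ} (hx : x ≠ 0) : Summable fun i : ℤ => ‖q ^ (i * i - i) * x ^ (2 * i)‖ := by
    have hq2 : ‖q ^ 2‖ < 1 := by
      rw [norm_pow]; exact pow_lt_one₀ (norm_nonneg q) hq two_ne_zero
    refine (summable_norm_theta (pow_ne_zero 2 hq0) hq2 (z := -x ^ 2) (by simpa)).congr fun i => ?_
    rw [neg_neg, ← zpow_natCast q 2, ← zpow_natCast x 2, ← zpow_mul, ← zpow_mul, Nat.cast_ofNat,
      two_mul_tri, mul_sub, mul_one]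
  have hB {x : ℂ} (hx : x ≠ 0) : Summable fun i : ℤ => ‖q ^ (i * i) * x ^ (2 * i)‖ := by
    have hq2 : ‖q ^ 2‖ < 1 := by
      rw [norm_pow]; exact pow_lt_one₀ (norm_nonneg q) hq two_ne_zero
    refine (summable_norm_theta (pow_ne_zero 2 hq0) hq2 (z := -(q * x ^ 2)) (by simp [hx, hq0])).congr
      fun i => ?_
    rw [neg_neg, ← zpow_natCast q 2, ← zpow_natCast x 2, mul_zpow, ← zpow_mul, ← zpow_mul,
      Nat.cast_ofNat, two_mul_tri, ← mul_assoc, ← zpow_add₀ hq0]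
    congr 3; ring
  have h := summable_mul_of_summable_norm
    (summable_norm_theta hq0 hq (mul_ne_zero hx hy)) (summable_norm_theta hq0 hq (div_ne_zero hx hy))
  have h' := paritySplit.summable_iff.mpr h
  have hs := Summable.tsum_sum (h'.comp_injective Sum.inl_injective)
    (h'.comp_injective Sum.inr_injective)
  simp only [Function.comp_apply] at hs
  rw [theta, theta, tsum_mul_tsum_of_summable_norm
    (summable_norm_theta hq0 hq (mul_ne_zero hx hy)) (summable_norm_theta hq0 hq (div_ne_zero hx hy)),
    tsum_mul_tsum_of_summable_norm (hA hx) (hB hy), tsum_mul_tsum_of_summable_norm (hB hx) (hA hy),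
    ← paritySplit.tsum_eq, hs, sub_eq_add_neg, ← tsum_mul_left, ← tsum_neg]
  have hexp (m n : ℤ) : q ^ tri m * (-(x * y)) ^ m * (q ^ tri n * (-(x / y)) ^ n)
      = q ^ (tri m + tri n) * (-1) ^ (m + n) * x ^ (m + n) * y ^ (m - n) := by
    rw [zpow_add₀ hq0, zpow_add₀ (by norm_num : (-1 : ℂ) ≠ 0), zpow_add₀ hx, zpow_sub₀ hy,
      neg_eq_neg_one_mul (x * y), neg_eq_neg_one_mul (x / y), mul_zpow, mul_zpow, mul_zpow, div_zpow]
    ring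
  congr 1
  · refine tsum_congr fun ⟨i, j⟩ => ?_
    have e : tri (i + j) + tri (i - j) = (i * i - i) + j * j := by
      have h1 := two_mul_tri (i + j)
      have h2 := two_mul_tri (i - j)
      linarith
    simp only [paritySplit, Equiv.coe_fn_mk, Sum.elim_inl]
    rw [hexp, e, show i + j + (i - j) = 2 * i by ring, show i + j - (i - j) = 2 * j by ring,
      zpow_add₀ hq0, zpow_mul (-1 : ℂ)]
    norm_num
    ring
  · refine tsum_congr fun ⟨i, j⟩ => ?_
    have e : tri (i + j) + tri (i + 1 - j) = i * i + (j * j - j) := by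
      have h1 := two_mul_tri (i + j)
      have h2 := two_mul_tri (i + 1 - j)
      linarith
    simp only [paritySplit, Equiv.coe_fn_mk, Sum.elim_inr]
    rw [hexp, e, show i + j + (i + 1 - j) = 2 * i + 1 by ring,
      show i + j - (i + 1 - j) = 2 * j - 1 by ring, zpow_add₀ hq0, zpow_add_one₀ hx,
      zpow_sub_one₀ hy, zpow_add_one₀ (by norm_num : (-1 : ℂ) ≠ 0), zpow_mul (-1 : ℂ)]
    norm_num
    ring

/-- The three-term relation for theta functions, specialised to the arguments `x, p, 1, p⁻²`. -/
lemma theta_three_term {q : ℂ} (hq0 : q ≠ 0) (hq : ‖q‖ < 1) {x p : ℂ} (hx : x ≠ 0) (hp : p ≠ 0) :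
    p * theta q (x * p) * theta q (x / p) * (theta q (1 / p ^ 2) * theta q (p ^ 2))
      - theta q x ^ 2 * (theta q (1 / p) * theta q (p ^ 3))
      + theta q (x / p ^ 2) * theta q (x * p ^ 2) * theta q p ^ 2 = 0 := by
  obtain ⟨A, B, h⟩ := exists_theta_mul_theta hq0 hq
  have h1 := h x p hx hp
  have h2 := h 1 (1 / p ^ 2) one_ne_zero (by simp [hp])
  have h3 := h x 1 hx one_ne_zero
  have h4 := h p (1 / p ^ 2) hp (by simp [hp])
  have h5 := h x (1 / p ^ 2) hx (by simp [hp])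
  have h6 := h p 1 hp one_ne_zero
  have e1 : p * (1 / p ^ 2) = 1 / p := by field_simp
  have e2 : p / (1 / p ^ 2) = p ^ 3 := by field_simp
  have e3 : x * (1 / p ^ 2) = x / p ^ 2 := by ring
  have e4 : x / (1 / p ^ 2) = x * p ^ 2 := by field_simp
  rw [one_mul, one_div_one_div] at h2
  rw [e1, e2] at h4
  rw [e3, e4] at h5
  rw [mul_one, div_one] at h3 h6
  calc
    _ = p * (theta q (x * p) * theta q (x / p)) * (theta q (1 / p ^ 2) * theta q (p ^ 2))
        - theta q x * theta q x * (theta q (1 / p) * theta q (p ^ 3))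
        + theta q (x / p ^ 2) * theta q (x * p ^ 2) * (theta q p * theta q p) := by ring
    _ = 0 := by
      rw [h1, h2, h3, h4, h5, h6]
      field_simp
      ring

/-- A degenerate three-term relation, expressing `3ρ(p) - ρ(p³) - 1` as a theta quotient, where
`ρ` is the logarithmic derivative of `θ`. -/
theorem thetaD_cubic {q : ℂ} (hq0 : q ≠ 0) (hq : ‖q‖ < 1) {p : ℂ} (hp : p ≠ 0) :
    -poch q q ^ 3 * theta q (p ^ 2) ^ 3 = 3 * theta q p ^ 2 * thetaD q p * theta q (p ^ 3)
      - theta q p ^ 3 * thetaD q (p ^ 3) - theta q p ^ 3 * theta q (p ^ 3) := by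
  have T {z : ℂ} (hz : z ≠ 0) := hasDerivAt_theta hq0 hq hz
  have hp2 := pow_ne_zero 2 hp
  have hp3 := pow_ne_zero 3 hp
  have d1 : HasDerivAt (fun x => theta q (x * p)) (thetaD q (p * p) / (p * p) * (1 * p)) p :=
    HasDerivAt.comp (h := fun x => x * p) p (T (mul_ne_zero hp hp)) ((hasDerivAt_id p).mul_const p)
  have d2 : HasDerivAt (fun x => theta q (x / p)) (thetaD q (p / p) / (p / p) * (1 / p)) p :=
    HasDerivAt.comp (h := fun x => x / p) p (T (div_ne_zero hp hp)) ((hasDerivAt_id p).div_const p)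
  have d3 := T hp
  have d4 : HasDerivAt (fun x => theta q (x / p ^ 2))
      (thetaD q (p / p ^ 2) / (p / p ^ 2) * (1 / p ^ 2)) p :=
    HasDerivAt.comp (h := fun x => x / p ^ 2) p (T (div_ne_zero hp hp2)) (
      (hasDerivAt_id p).div_const (p ^ 2))
  have d5 : HasDerivAt (fun x => theta q (x * p ^ 2))
      (thetaD q (p * p ^ 2) / (p * p ^ 2) * (1 * p ^ 2)) p :=
    HasDerivAt.comp (h := fun x => x * p ^ 2) p (T (mul_ne_zero hp hp2)) (
      (hasDerivAt_id p).mul_const (p ^ 2))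
  have d := ((((d1.const_mul p).mul d2).mul_const (theta q (1 / p ^ 2) * theta q (p ^ 2))).sub
    ((d3.pow 2).mul_const (theta q (1 / p) * theta q (p ^ 3)))).add
    ((d4.mul d5).mul_const (theta q p ^ 2))
  have d0 := (hasDerivAt_const p (0 : ℂ)).congr_of_eventuallyEq (f₁ := fun x =>
    p * theta q (x * p) * theta q (x / p) * (theta q (1 / p ^ 2) * theta q (p ^ 2))
      - theta q x ^ 2 * (theta q (1 / p) * theta q (p ^ 3))
      + theta q (x / p ^ 2) * theta q (x * p ^ 2) * theta q p ^ 2) (by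
      filter_upwards [isOpen_ne.mem_nhds hp] with x hx using theta_three_term hq0 hq hx hp)
  have h := d.unique d0
  have e1 : p / p = 1 := div_self hp
  have e2 : p / p ^ 2 = 1 / p := by field_simp
  have e3 : p * p ^ 2 = p ^ 3 := by ring
  have e4 : p * p = p ^ 2 := by ring
  have t1 : theta q 1 = 0 := by
    have := theta_inv hq0 one_ne_zero
    rw [one_mul, div_one] at this
    exact self_eq_neg.mp this
  have i1 := theta_inv hq0 hp
  have i2 := theta_inv hq0 hp2
  have i3 := thetaD_inv hq0 hq hp
  rw [mul_comm, ← eq_div_iff (by assumption)] at i1 i2 i3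
  simp only [e1, e2, e3, e4, t1, i1, i2, i3, thetaD_one hq0 hq] at h
  field_simp at h
  push_cast at h
  linear_combination -h

end

/-- The multisets of naturals below `N`. -/
def multisetLT (N : ℕ) : Set (Multiset ℕ) := {s | ∀ x ∈ s, x < N}

/-- A multiset of naturals below `N + 1` is a multiplicity of `N` and a multiset of naturals
below `N`. -/
def multisetLTSucc (N : ℕ) :
    ℕ × multisetLT N ≃ multisetLT (N + 1) where
  toFun p := ⟨Multiset.replicate p.1 N + p.2.1, fun x hx => by
    rcases Multiset.mem_add.mp hx with h | h
    · rw [Multiset.eq_of_mem_replicate h]; omega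
    · have := p.2.2 x h; omega⟩
  invFun s := (s.1.count N, ⟨s.1.filter (· < N), fun x hx => (Multiset.mem_filter.mp hx).2⟩)
  left_inv := by
    rintro ⟨k, s, hs⟩
    have h1 : s.count N = 0 := Multiset.count_eq_zero_of_notMem fun h => (hs N h).false
    have h2 : (Multiset.replicate k N).filter (· < N) = 0 :=
      Multiset.filter_eq_nil.mpr fun x hx => by rw [Multiset.eq_of_mem_replicate hx]; omega
    have h3 : s.filter (· < N) = s := Multiset.filter_eq_self.mpr hs
    simp [h1, h2, h3]
  right_inv := by
    rintro ⟨s, hs⟩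
    ext1
    have : s.filter (N = ·) = s.filter fun x => ¬ x < N :=
      Multiset.filter_congr fun x hx => by have := hs x hx; omega
    simp only [← Multiset.filter_eq, this]
    rw [add_comm, Multiset.filter_add_not]

lemma hasSum_multiset_lt {𝕜 : Type*} [NormedField 𝕜] [CompleteSpace 𝕜] {a : ℕ → 𝕜}
    (ha : ∀ i, ‖a i‖ < 1) (N : ℕ) :
    Summable (fun s : multisetLT N => ‖(s.1.map a).prod‖) ∧
    HasSum (fun s : multisetLT N => (s.1.map a).prod)
      (∏ i ∈ Finset.range N, (1 - a i))⁻¹ := by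
  induction N with
  | zero =>
    have h (s : multisetLT 0) : s.1 = 0 :=
      Multiset.eq_zero_of_forall_notMem fun x hx => absurd (s.2 x hx) (Nat.not_lt_zero x)
    let : Unique (multisetLT 0) :=
      ⟨⟨⟨0, fun x hx => absurd hx (Multiset.notMem_zero x)⟩⟩, fun s => Subtype.ext (h s)⟩
    refine ⟨(hasSum_unique _).summable, hasSum_of_eq (hasSum_unique _ _) (fun _ => rfl) ?_⟩
    rw [h]
    simp
  | succ N ih =>
    have hg := hasSum_geometric_of_norm_lt_one (ha N)
    have hgn : Summable fun k => ‖a N ^ k‖ := by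
      simpa only [norm_pow] using summable_geometric_of_lt_one (norm_nonneg _) (ha N)
    have hm := summable_mul_of_summable_norm hgn ih.1
    have hmn := hgn.mul_norm ih.1
    have he (p : ℕ × multisetLT N) :
        ((multisetLTSucc N p).1.map a).prod = a N ^ p.1 * (p.2.1.map a).prod := by
      simp [multisetLTSucc, Multiset.map_add]
    rw [← (multisetLTSucc N).summable_iff, ← (multisetLTSucc N).hasSum_iff]
    simp only [Function.comp_def, he]
    refine ⟨hmn, ?_⟩
    rw [Finset.prod_range_succ, mul_inv, mul_comm]
    have hprod := HasSum.mul hg ih.2 hm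
    exact hprod

lemma tendsto_inv_prod_one_sub {𝕜 : Type*} [RCLike 𝕜] {a : ℕ → 𝕜} (ha : ∀ i, ‖a i‖ < 1)
    (hs : Summable fun i => ‖a i‖) :
    Tendsto (fun N => (∏ i ∈ Finset.range N, (1 - a i))⁻¹) atTop (𝓝 (∏' i, (1 - a i))⁻¹) := by
  have hs' : Summable fun i => ‖-a i‖ := by simpa using hs
  have hm := multipliable_one_add_of_summable hs'
  have hne := tprod_one_add_ne_zero_of_summable (f := fun i => -a i) (fun i h => by
    have := ha i
    rw [add_neg_eq_zero] at h
    simp [← h] at this) hs'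
  simp only [← sub_eq_add_neg] at hm hne
  exact hm.hasProd.tendsto_prod_nat.inv₀ hne

/-- The generating function of finite multisets of naturals with multiplicative weights. -/
theorem hasSum_multiset {a : ℕ → ℂ} (ha : ∀ i, ‖a i‖ < 1) (hs : Summable fun i => ‖a i‖) :
    Summable (fun s : Multiset ℕ => ‖(s.map a).prod‖) ∧
    HasSum (fun s : Multiset ℕ => (s.map a).prod) (∏' i, (1 - a i))⁻¹ := by
  have hnorm (s : Multiset ℕ) : ‖(s.map a).prod‖ = (s.map fun i => ‖a i‖).prod := by
    induction s using Multiset.induction_on with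
    | empty => simp
    | cons i s ih => simp [ih]
  have hev (s : Multiset ℕ) : ∀ᶠ N in atTop, s ∈ multisetLT N := by
    filter_upwards [eventually_gt_atTop s.sup] with N hN x hx
    exact (Multiset.le_sup hx).trans_lt hN
  have hsum : Summable fun s : Multiset ℕ => ‖(s.map a).prod‖ := by
    obtain ⟨C, hC⟩ := (tendsto_inv_prod_one_sub (𝕜 := ℝ) (a := fun i => ‖a i‖) (by simpa using ha)
      (by simpa using hs)).bddAbove_range
    refine summable_of_sum_le (c := C) (fun s => norm_nonneg _) fun u => ?_
    obtain ⟨N, hN⟩ := ((Filter.eventually_all_finset u).mpr fun s _ => hev s).exists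
    have h := (hasSum_multiset_lt (𝕜 := ℝ) (a := fun i => ‖a i‖) (by simpa using ha) N).2
    have h := (hasSum_subtype_iff_indicator
      (f := fun s : Multiset ℕ => (s.map fun i => ‖a i‖).prod)).mp h
    refine le_trans ?_ (hC (Set.mem_range_self N))
    refine le_trans (le_of_eq ?_) (sum_le_hasSum u (fun s _ => Set.indicator_nonneg (fun s _ => ?_) s) h)
    · refine Finset.sum_congr rfl fun s hs => ?_
      rw [Set.indicator_of_mem (hN s hs), hnorm]
    · rw [← hnorm]; exact norm_nonneg _
  refine ⟨hsum, ?_⟩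
  have h (N : ℕ) := (hasSum_subtype_iff_indicator
    (f := fun s : Multiset ℕ => (s.map a).prod)).mp (hasSum_multiset_lt ha N).2
  have hlim := tendsto_tsum_of_dominated_convergence (𝓕 := atTop)
    (f := fun (N : ℕ) => (multisetLT N).indicator fun s : Multiset ℕ => (s.map a).prod)
    (g := fun s => (s.map a).prod) hsum
    (fun s => tendsto_const_nhds.congr' <| by
      filter_upwards [hev s] with N hN
      rw [Set.indicator_of_mem hN])
    (.of_forall fun N s => norm_indicator_le_norm_self _ _)
  simp only [(h _).tsum_eq] at hlim
  rw [tendsto_nhds_unique (tendsto_inv_prod_one_sub ha hs) hlim]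
  exact hsum.of_norm.hasSum

section

/-- Partitions of arbitrary integers are multisets of positive integers. -/
def sigmaPartitionEquiv : (Σ n : ℕ, n.Partition) ≃ {P : Multiset ℕ // ∀ x ∈ P, 0 < x} where
  toFun x := ⟨x.2.parts, fun _ h => x.2.parts_pos h⟩
  invFun P := ⟨P.1.sum, ⟨P.1, fun {_} h => P.2 _ h, rfl⟩⟩
  left_inv := by
    rintro ⟨_, ⟨P, hp, rfl⟩⟩
    rfl
  right_inv _ := rfl

/-- A multiset of positive integers is a number of ones together with a multiset of larger
integers, shifted down to start at zero. -/
def posMultisetEquiv : ℕ × Multiset ℕ ≃ {P : Multiset ℕ // ∀ x ∈ P, 0 < x} where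
  toFun p := ⟨Multiset.replicate p.1 1 + p.2.map (· + 2), fun x hx => by
    rcases Multiset.mem_add.mp hx with h | h
    · rw [Multiset.eq_of_mem_replicate h]; exact one_pos
    · obtain ⟨y, -, rfl⟩ := Multiset.mem_map.mp h; positivity⟩
  invFun P := (P.1.count 1, (P.1.filter (1 < ·)).map (· - 2))
  left_inv := by
    rintro ⟨k, s⟩
    have h1 : (s.map (· + 2)).count 1 = 0 := Multiset.count_eq_zero_of_notMem fun h => by
      obtain ⟨y, -, hy⟩ := Multiset.mem_map.mp h
      omega
    have h2 : (Multiset.replicate k 1).filter (1 < ·) = 0 :=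
      Multiset.filter_eq_nil.mpr fun x hx => by rw [Multiset.eq_of_mem_replicate hx]; omega
    have h3 : (s.map (· + 2)).filter (1 < ·) = s.map (· + 2) :=
      Multiset.filter_eq_self.mpr fun x hx => by
        obtain ⟨y, -, rfl⟩ := Multiset.mem_map.mp hx
        omega
    simp [h2, h3]
  right_inv := by
    rintro ⟨P, hP⟩
    ext1
    have h1 : P.filter (1 = ·) = P.filter fun x => ¬ 1 < x :=
      Multiset.filter_congr fun x hx => by have := hP x hx; omega
    have h2 : ((P.filter (1 < ·)).map (· - 2)).map (· + 2) = P.filter (1 < ·) := by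
      rw [Multiset.map_map]
      refine (Multiset.map_congr rfl fun x hx => ?_).trans (Multiset.map_id _)
      have := (Multiset.mem_filter.mp hx).2
      simp only [Function.comp_apply, id]
      omega
    simp only [← Multiset.filter_eq, h1, h2]
    rw [add_comm, Multiset.filter_add_not]

/-- The weight of a part `i + 2` in the crank generating function of partitions with `k` ones. -/
noncomputable def crankWeight (q z : ℂ) (k i : ℕ) : ℂ := (if k < i + 2 then z else 1) * q ^ (i + 2)

lemma prod_crankWeight (q z : ℂ) (k : ℕ) (s : Multiset ℕ) :
    (s.map (crankWeight q z k)).prod =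
      z ^ Multiset.card ((s.map (· + 2)).filter (k < ·)) * q ^ (s.map (· + 2)).sum := by
  induction s using Multiset.induction_on with
  | empty => simp
  | cons i s ih =>
    simp only [Multiset.map_cons, Multiset.prod_cons, ih, crankWeight, Multiset.sum_cons,
      Multiset.filter_cons]
    split_ifs <;> simp [pow_add] <;> ring

lemma crank_term_eq {q z : ℂ} (hz : z ≠ 0) (p : ℕ × Multiset ℕ) :
    (fun x : Σ n : ℕ, n.Partition => (omegaOnes x.2 : ℂ) * z ^ crank x.2 * q ^ x.1)
      (sigmaPartitionEquiv.symm (posMultisetEquiv p)) =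
      p.1 * (q / z) ^ p.1 * (p.2.map (crankWeight q z p.1)).prod := by
  obtain ⟨k, s⟩ := p
  have h1 : (s.map (· + 2)).count 1 = 0 := Multiset.count_eq_zero_of_notMem fun h => by
    obtain ⟨y, -, hy⟩ := Multiset.mem_map.mp h
    omega
  have hk : (Multiset.replicate k 1 + s.map (· + 2)).count 1 = k := by
    rw [Multiset.count_add, h1, Multiset.count_replicate_self, add_zero]
  rcases Nat.eq_zero_or_pos k with rfl | hpos
  · simp [sigmaPartitionEquiv, posMultisetEquiv, omegaOnes]
  · have h2 : (Multiset.replicate k 1).filter (k < ·) = 0 :=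
      Multiset.filter_eq_nil.mpr fun x hx => by rw [Multiset.eq_of_mem_replicate hx]; omega
    simp only [sigmaPartitionEquiv, posMultisetEquiv, omegaOnes, crank, muParts, Equiv.coe_fn_mk,
      Equiv.coe_fn_symm_mk, hk, hpos.ne', if_false, prod_crankWeight, Multiset.filter_add, h2,
      zero_add, Multiset.sum_add, Multiset.sum_replicate, smul_eq_mul, mul_one, pow_add, div_pow,
      zpow_sub₀ hz, zpow_natCast]
    ring

variable {q z : ℂ} (hq : ‖q‖ < 1) (hz : ‖z‖ = 1)
include hq hz

omit hq in
lemma norm_crankWeight (k i : ℕ) : ‖crankWeight q z k i‖ = ‖q ^ (i + 2)‖ := by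
  rw [crankWeight, norm_mul]
  split_ifs <;> simp [hz]

lemma norm_crankWeight_lt_one (k i : ℕ) : ‖crankWeight q z k i‖ < 1 := by
  rw [norm_crankWeight hz, norm_pow]
  exact pow_lt_one₀ (norm_nonneg q) hq (by omega)

lemma summable_norm_crankWeight (k : ℕ) : Summable fun i => ‖crankWeight q z k i‖ := by
  simp only [norm_crankWeight hz, norm_pow]
  exact (summable_nat_add_iff 2).mpr (summable_geometric_of_lt_one (norm_nonneg q) hq)

lemma tprod_crankWeight (k : ℕ) : ∏' i, (1 - crankWeight q z (k + 1) i) =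
    (∏ i ∈ Finset.range k, (1 - q ^ (i + 2))) * poch (z * q * q ^ (k + 1)) q := by
  have hm : Multipliable fun i : ℕ => 1 - crankWeight q z (k + 1) i := by
    have := multipliable_one_add_of_summable (f := fun i : ℕ => -crankWeight q z (k + 1) i)
      (by simpa using summable_norm_crankWeight hq hz (k + 1))
    simpa only [← sub_eq_add_neg] using this
  have h2 := (tendsto_prod_poch hq (z * q * q ^ (k + 1))).const_mul
    (∏ i ∈ Finset.range k, (1 - q ^ (i + 2)))
  refine tendsto_nhds_unique ((tendsto_add_atTop_iff_nat k).mpr hm.hasProd.tendsto_prod_nat)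
    (h2.congr fun n => ?_)
  rw [add_comm n k, Finset.prod_range_add]
  congr 1
  · refine Finset.prod_congr rfl fun i hi => ?_
    rw [crankWeight, if_neg (by rw [Finset.mem_range] at hi; omega), one_mul]
  · refine Finset.prod_congr rfl fun i _ => ?_
    rw [crankWeight, if_pos (by omega)]
    ring

/-- The generating function of the number of ones, refined by the crank. -/
theorem hasSum_omega_crank :
    HasSum (fun n : ℕ => (∑ π : n.Partition, (omegaOnes π : ℂ) * z ^ crank π) * q ^ n)
      ((1 - q) / poch (z * q) q * (q / z *
        deriv (fun t => poch (z * q * t) q / poch t q) (q / z))) := by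
  have hz0 : z ≠ 0 := by rw [← norm_ne_zero_iff, hz]; exact one_ne_zero
  have ht : ‖q / z‖ < 1 := by rwa [norm_div, hz, div_one]
  have hzq : ‖z * q‖ < 1 := by rwa [norm_mul, hz, one_mul]
  have hin (k : ℕ) := hasSum_multiset (norm_crankWeight_lt_one hq hz k)
    (summable_norm_crankWeight hq hz k)
  have hsum : Summable fun p : ℕ × Multiset ℕ =>
      (p.1 : ℂ) * (q / z) ^ p.1 * (p.2.map (crankWeight q z p.1)).prod := by
    have h1 : Summable fun k : ℕ => ‖(k : ℂ) * (q / z) ^ k‖ := by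
      simpa using summable_norm_pow_mul_geometric_of_norm_lt_one 1 ht
    refine Summable.of_norm ((h1.mul_norm (hin 0).1).congr fun p => ?_)
    have : ‖(p.2.map (crankWeight q z 0)).prod‖ = ‖(p.2.map (crankWeight q z p.1)).prod‖ := by
      simp only [prod_crankWeight, norm_mul, norm_pow, hz, one_pow]
    rw [norm_mul, norm_mul _ (Multiset.prod _), this]
  have hout := (hasSum_mul_qbinom hq (z * q) ht).mul_left ((1 - q) / poch (z * q) q)
  have hfib (k : ℕ) : HasSum (fun s : Multiset ℕ =>
      (k : ℂ) * (q / z) ^ k * (s.map (crankWeight q z k)).prod)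
      ((1 - q) / poch (z * q) q * (k * (qbinomCoeff (z * q) q k * (q / z) ^ k))) := by
    refine hasSum_of_eq ((hin k).2.mul_left _) (fun _ => rfl) ?_
    rcases k with _ | k
    · simp
    · have hn (i : ℕ) : 1 - q ^ (i + 1) ≠ 0 := one_sub_ne_zero_of_norm_lt_one (by
        rw [norm_pow]; exact pow_lt_one₀ (norm_nonneg q) hq (by omega))
      have hn' (i : ℕ) : 1 - z * q * q ^ i ≠ 0 :=
        one_sub_ne_zero_of_norm_lt_one (norm_mul_pow_lt_one hq hzq i)
      have hP : poch (z * q * q ^ (k + 1)) q ≠ 0 :=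
        poch_ne_zero_of_norm_lt_one hq (norm_mul_pow_lt_one hq hzq _)
      have hN : ∏ j ∈ Finset.range (k + 1), (1 - z * q * q ^ j) ≠ 0 :=
        Finset.prod_ne_zero_iff.mpr fun i _ => hn' i
      have hD : ∏ i ∈ Finset.range k, (1 - q ^ (i + 2)) ≠ 0 :=
        Finset.prod_ne_zero_iff.mpr fun i _ => hn (i + 1)
      have h1 := hn 0
      have hE : ∏ j ∈ Finset.range (k + 1), (1 - q * q ^ j)
          = (1 - q) * ∏ i ∈ Finset.range k, (1 - q ^ (i + 2)) := by
        rw [Finset.prod_range_succ', mul_comm, pow_zero, mul_one]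
        congr 1
        refine Finset.prod_congr rfl fun i _ => ?_
        ring
      rw [zero_add, pow_one] at h1
      rw [tprod_crankWeight hq hz, qbinomCoeff, Finset.prod_div_distrib, hE,
        poch_eq_prod_mul hq (z * q) (k + 1)]
      generalize poch (z * q * q ^ (k + 1)) q = P at hP ⊢
      generalize ∏ j ∈ Finset.range (k + 1), (1 - z * q * q ^ j) = N at hN ⊢
      field_simp
  have htot := (hsum.hasSum.prod_fiberwise hfib).unique hout
  have h := hsum.hasSum
  rw [htot] at h
  have h' : HasSum (fun x : Σ n : ℕ, n.Partition => (omegaOnes x.2 : ℂ) * z ^ crank x.2 * q ^ x.1)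
      _ := (Equiv.hasSum_iff (posMultisetEquiv.trans sigmaPartitionEquiv.symm)).mp
        (hasSum_of_eq h (crank_term_eq hz0) rfl)
  refine hasSum_of_eq (h'.sigma fun n => hasSum_fintype _) (fun n => ?_) rfl
  rw [Finset.sum_mul]

end

lemma div_mul_deriv_poch_quotient {q z : ℂ} (hq : ‖q‖ < 1) (hz : ‖z‖ = 1) :
    (1 - q) / poch (z * q) q * (q / z * deriv (fun t => poch (z * q * t) q / poch t q) (q / z)) =
      (1 - q) * q ^ 2 * deriv (fun a => poch a q) (q ^ 2) / (poch (z * q) q * poch (q / z) q)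
      - poch q q * (q / z * deriv (fun a => poch a q) (q / z))
        / (poch (z * q) q * poch (q / z) q ^ 2) := by
  have hz0 : z ≠ 0 := by rw [← norm_ne_zero_iff, hz]; exact one_ne_zero
  have ht : ‖q / z‖ < 1 := by rwa [norm_div, hz, div_one]
  have hzq : ‖z * q‖ < 1 := by rwa [norm_mul, hz, one_mul]
  have hP1 := poch_ne_zero_of_norm_lt_one hq hzq
  have hP2 := poch_ne_zero_of_norm_lt_one hq ht
  have e : z * q * (q / z) = q ^ 2 := by field_simp
  have hD (a : ℂ) : HasDerivAt (fun a => poch a q) (deriv (fun a => poch a q) a) a :=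
    (differentiable_poch hq a).hasDerivAt
  have h1 : HasDerivAt (fun t => poch (z * q * t) q)
      (deriv (fun a => poch a q) (z * q * (q / z)) * (z * q * 1)) (q / z) :=
    HasDerivAt.comp (h := fun t => z * q * t) (q / z) (hD _) ((hasDerivAt_id _).const_mul (z * q))
  have h2 : HasDerivAt (fun t => poch (z * q * t) q / poch t q) _ (q / z) := h1.div (hD _) hP2
  rw [h2.deriv, e, poch_succ hq q, ← sq]
  field_simp

/-- The odd part in `z` of the crank generating function, as a theta quotient. -/
theorem crank_odd_part_eq {q z : ℂ} (hq0 : q ≠ 0) (hq : ‖q‖ < 1) (hz : ‖z‖ = 1) (hz1 : z ≠ 1) :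
    (1 - q) / poch (z * q) q * (q / z * deriv (fun t => poch (z * q * t) q / poch t q) (q / z))
      - (1 - q) / poch (z⁻¹ * q) q *
        (q / z⁻¹ * deriv (fun t => poch (z⁻¹ * q * t) q / poch t q) (q / z⁻¹)) =
      poch q q ^ 2 * ((1 - z) * thetaD q z + z * theta q z) / theta q z ^ 2 := by
  have hz0 : z ≠ 0 := by rw [← norm_ne_zero_iff, hz]; exact one_ne_zero
  have hzi : ‖z⁻¹‖ = 1 := by rw [norm_inv, hz, inv_one]
  have ht : ‖q / z‖ < 1 := by rwa [norm_div, hz, div_one]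
  have hzq : ‖z * q‖ < 1 := by rwa [norm_mul, hz, one_mul]
  have hP0 := poch_ne_zero_of_norm_lt_one hq hq
  have hP1 := poch_ne_zero_of_norm_lt_one hq hzq
  have hP2 := poch_ne_zero_of_norm_lt_one hq ht
  have h1z : 1 - z ≠ 0 := sub_ne_zero.mpr hz1.symm
  rw [div_mul_deriv_poch_quotient hq hz, div_mul_deriv_poch_quotient hq hzi, inv_mul_eq_div,
    div_inv_eq_mul, mul_comm q z]
  have hD (a : ℂ) : HasDerivAt (fun a => poch a q) (deriv (fun a => poch a q) a) a :=
    (differentiable_poch hq a).hasDerivAt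
  have d1 : HasDerivAt (fun t => poch (t * q) q)
      (deriv (fun a => poch a q) (z * q) * (1 * q)) z :=
    HasDerivAt.comp (h := fun t => t * q) z (hD _) ((hasDerivAt_id _).mul_const q)
  have d2 : HasDerivAt (fun t => poch (q / t) q) (deriv (fun a => poch a q) (q / z) * (-q / z ^ 2)) z :=
    HasDerivAt.comp (h := fun t => q / t) z (hD _) (by
      simpa [div_eq_mul_inv] using (hasDerivAt_inv hz0).const_mul q)
  have hθ (t : ℂ) (ht : t ≠ 0) :
      theta q t = (1 - t) * (poch (t * q) q * poch (q / t) q) * poch q q := by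
    rw [theta_eq_poch hq0 hq ht, poch_succ hq t]
    ring
  have d : HasDerivAt (fun t => (1 - t) * (poch (t * q) q * poch (q / t) q) * poch q q) _ z :=
    (((hasDerivAt_id z).const_sub 1).mul (d1.mul d2)).mul_const _
  have d' := d.congr_of_eventuallyEq (f₁ := theta q) (by
    filter_upwards [isOpen_ne.mem_nhds hz0] with t ht using hθ t ht)
  rw [thetaD, d'.deriv, hθ z hz0]
  simp only [id, Pi.mul_apply]
  generalize poch q q = P0 at *
  generalize poch (z * q) q = P1 at *
  generalize poch (q / z) q = P2 at *
  field_simp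
  ring

/-- Product of `(ζʲ q; q)_∞` over the fifth roots of unity, in theta form. -/
lemma theta_mul_theta_sq {q ζ : ℂ} (hq0 : q ≠ 0) (hq : ‖q‖ < 1)
    (hζ : 1 + ζ + ζ ^ 2 + ζ ^ 3 + ζ ^ 4 = 0) :
    theta q ζ * theta q (ζ ^ 2) =
      (1 - ζ) * (1 - ζ ^ 2) * (poch q q * poch (q ^ 5) (q ^ 5)) := by
  have h5 : ζ ^ 5 = 1 := by linear_combination (ζ - 1) * hζ
  have hζ0 : ζ ≠ 0 := by rintro rfl; simp at hζ
  have e1 : q / ζ = ζ ^ 4 * q := by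
    field_simp
    linear_combination -h5
  have e2 : q / ζ ^ 2 = ζ ^ 3 * q := by
    field_simp
    linear_combination -h5
  have hq5 : ‖q ^ 5‖ < 1 := by
    rw [norm_pow]; exact pow_lt_one₀ (norm_nonneg q) hq (by norm_num)
  have key : poch q q * (poch (ζ * q) q * poch (ζ ^ 4 * q) q) *
      (poch (ζ ^ 2 * q) q * poch (ζ ^ 3 * q) q) = poch (q ^ 5) (q ^ 5) := by
    have h := (((tendsto_prod_poch hq q).mul ((tendsto_prod_poch hq (ζ * q)).mul
      (tendsto_prod_poch hq (ζ ^ 4 * q)))).mul ((tendsto_prod_poch hq (ζ ^ 2 * q)).mul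
      (tendsto_prod_poch hq (ζ ^ 3 * q))))
    refine tendsto_nhds_unique h ((tendsto_prod_poch hq5 (q ^ 5)).congr fun n => ?_)
    simp only [← Finset.prod_mul_distrib]
    refine Finset.prod_congr rfl fun i _ => ?_
    set x := q * q ^ i with hx
    have hx5 : q ^ 5 * (q ^ 5) ^ i = x ^ 5 := by rw [hx]; ring
    rw [hx5, mul_assoc ζ, mul_assoc (ζ ^ 4), mul_assoc (ζ ^ 2), mul_assoc (ζ ^ 3), ← hx]
    linear_combination (x - x ^ 2 * ζ - x ^ 2 * ζ ^ 3 + x ^ 3 * ζ ^ 3 + x ^ 3 * ζ ^ 5 - x ^ 4 * ζ ^ 6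
      - x ^ 5 + x ^ 5 * ζ - x ^ 5 * ζ ^ 5 + x ^ 5 * ζ ^ 6) * hζ
  rw [theta_eq_poch hq0 hq hζ0, theta_eq_poch hq0 hq (pow_ne_zero 2 hζ0), poch_succ hq ζ,
    poch_succ hq (ζ ^ 2), e1, e2, ← key]
  ring

section

/-- A sum over the integers splits into the sums over residue classes modulo `5`. -/
lemma hasSum_int_dissect {f : ℤ → ℂ} {a : ℂ} {g : Fin 5 → ℂ} (hf : HasSum f a)
    (hg : ∀ r : Fin 5, HasSum (fun m : ℤ => f (5 * m + (r : ℕ))) (g r)) : a = ∑ r, g r := by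
  have e := ((Equiv.prodComm _ _).trans (Int.divModEquiv 5).symm).hasSum_iff.mpr hf
  refine (HasSum.prod_fiberwise e (g := g) fun r => ?_).unique (hasSum_fintype g)
  refine hasSum_of_eq (hg r) (fun m => ?_) rfl
  simp [Int.divModEquiv, mul_comm]

lemma tri_five_mul_add (m r : ℤ) : tri (5 * m + r) = 25 * tri m + (10 + 5 * r) * m + tri r := by
  have h1 := two_mul_tri m
  have h2 := two_mul_tri r
  have h3 := two_mul_tri (5 * m + r)
  linarith

variable {q z : ℂ} (hq0 : q ≠ 0) (hq : ‖q‖ < 1)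
include hq0

lemma theta_term_five (hz : z ^ 5 = 1) (m : ℤ) (r : ℕ) :
    q ^ tri (5 * m + r) * (-z) ^ (5 * m + r : ℤ) =
      (-z) ^ r * q ^ tri r * ((q ^ 25) ^ tri m * (-q ^ (10 + 5 * r)) ^ m) := by
  have hz0 : z ≠ 0 := by rintro rfl; simp at hz
  have h1 : (-z) ^ (5 * m + r : ℤ) = (-1) ^ m * (-z) ^ r := by
    rw [zpow_add₀ (neg_ne_zero.mpr hz0), zpow_natCast, zpow_mul]
    congr 2
    rw [show (5 : ℤ) = (5 : ℕ) from rfl, zpow_natCast, Odd.neg_pow (by decide), hz]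
  have h2 : (-q ^ (10 + 5 * r)) ^ m = (-1) ^ m * q ^ ((10 + 5 * (r : ℤ)) * m) := by
    rw [neg_eq_neg_one_mul, mul_zpow, ← zpow_natCast q, ← zpow_mul]
    push_cast
    rfl
  have h3 : (q ^ 25) ^ tri m = q ^ (25 * tri m) := by
    rw [zpow_mul]
    rfl
  rw [h1, h2, h3, tri_five_mul_add, zpow_add₀ hq0, zpow_add₀ hq0]
  ring

include hq

omit hq0 in
lemma norm_pow_twentyFive : ‖q ^ 25‖ < 1 := by
  rw [norm_pow]; exact pow_lt_one₀ (norm_nonneg q) hq (by norm_num)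

lemma theta_dissect_aux (hz : z ^ 5 = 1) : theta q z =
    ∑ r : Fin 5, (-z) ^ (r : ℕ) * q ^ tri (r : ℕ) * theta (q ^ 25) (q ^ (10 + 5 * (r : ℕ))) := by
  have hz0 : z ≠ 0 := by rintro rfl; simp at hz
  have hQ := norm_pow_twentyFive hq
  refine hasSum_int_dissect (hasSum_theta hq0 hq hz0) fun r => ?_
  exact hasSum_of_eq ((hasSum_theta (pow_ne_zero 25 hq0) hQ (pow_ne_zero _ hq0)).mul_left _)
    (fun m => theta_term_five hq0 hz m r) rfl

lemma thetaD_dissect_aux (hz : z ^ 5 = 1) : thetaD q z =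
    ∑ r : Fin 5, (-z) ^ (r : ℕ) * q ^ tri (r : ℕ) *
      (5 * thetaD (q ^ 25) (q ^ (10 + 5 * (r : ℕ))) +
        (r : ℕ) * theta (q ^ 25) (q ^ (10 + 5 * (r : ℕ)))) := by
  have hz0 : z ≠ 0 := by rintro rfl; simp at hz
  have hQ := norm_pow_twentyFive hq
  refine hasSum_int_dissect (hasSum_thetaD hq0 hq hz0) fun r => ?_
  have h := (((hasSum_thetaD (pow_ne_zero 25 hq0) hQ
    (pow_ne_zero (10 + 5 * (r : ℕ)) hq0)).mul_left 5).add
    ((hasSum_theta (pow_ne_zero 25 hq0) hQ (pow_ne_zero (10 + 5 * (r : ℕ)) hq0)).mul_left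
      ((r : ℕ) : ℂ))).mul_left ((-z) ^ (r : ℕ) * q ^ tri (r : ℕ))
  refine hasSum_of_eq h (fun m => ?_) rfl
  rw [theta_term_five hq0 hz m r]
  push_cast
  ring

omit hq in
lemma theta_one : theta q 1 = 0 := by
  have := theta_inv hq0 one_ne_zero
  rw [one_mul, div_one] at this
  exact self_eq_neg.mp this

omit hq hq0 in
lemma pow_div_pow_eq (hq0 : q ≠ 0) (m n : ℕ) : q ^ (m + n) / q ^ m = q ^ n := by
  rw [pow_add, mul_div_cancel_left₀ _ (pow_ne_zero m hq0)]

lemma theta_dissect (hz : z ^ 5 = 1) : theta q z =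
    (1 - z) * theta (q ^ 25) (q ^ 10) + q * (z ^ 2 - z ^ 4) * theta (q ^ 25) (q ^ 5) := by
  have hQ0 := pow_ne_zero 25 hq0
  have h1 := theta_reflect hQ0 (q ^ 10)
  have h2 := theta_reflect hQ0 (q ^ 5)
  rw [pow_div_pow_eq hq0 10 15] at h1
  rw [pow_div_pow_eq hq0 5 20] at h2
  have h3 : theta (q ^ 25) (q ^ 25) = 0 := by
    simpa [theta_one hQ0] using theta_mul_q hQ0 one_ne_zero
  have h4 := theta_mul_q hQ0 (pow_ne_zero 5 hq0)
  rw [← pow_add] at h4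
  have t0 : tri 0 = 0 := rfl
  have t1 : tri 1 = 0 := rfl
  have t2 : tri 2 = 1 := rfl
  have t4 : tri 4 = 6 := rfl
  have e : q ^ (6 : ℤ) = q ^ 6 := rfl
  rw [theta_dissect_aux hq0 hq hz, Fin.sum_univ_five]
  simp only [Fin.coe_ofNat_eq_mod, Nat.reduceMod,
    Nat.cast_ofNat, Nat.cast_zero, Nat.cast_one, t0, t1, t2, t4, e, zpow_zero, zpow_one, Nat.reduceMul,
    Nat.reduceAdd, h1, h2, h3] at h4 ⊢
  linear_combination z ^ 4 * q * h4

lemma thetaD_dissect (hz : z ^ 5 = 1) : thetaD q z =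
    5 * thetaD (q ^ 25) (q ^ 10)
      + z * (5 * thetaD (q ^ 25) (q ^ 10) - theta (q ^ 25) (q ^ 10))
      + q * (z ^ 2 * (2 * theta (q ^ 25) (q ^ 5) - 5 * thetaD (q ^ 25) (q ^ 5))
        + z ^ 4 * (theta (q ^ 25) (q ^ 5) - 5 * thetaD (q ^ 25) (q ^ 5)))
      - 5 * z ^ 3 * q ^ 3 * thetaD (q ^ 25) (q ^ 25) := by
  have hQ0 := pow_ne_zero 25 hq0
  have hQ := norm_pow_twentyFive hq
  have h1 := theta_reflect hQ0 (q ^ 10)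
  have h2 := theta_reflect hQ0 (q ^ 5)
  have d1 := thetaD_reflect hQ0 hQ (pow_ne_zero 10 hq0)
  have d2 := thetaD_reflect hQ0 hQ (pow_ne_zero 5 hq0)
  rw [pow_div_pow_eq hq0 10 15] at h1 d1
  rw [pow_div_pow_eq hq0 5 20] at h2 d2
  have h3 : theta (q ^ 25) (q ^ 25) = 0 := by
    simpa [theta_one hQ0] using theta_mul_q hQ0 one_ne_zero
  have h4 := theta_mul_q hQ0 (pow_ne_zero 5 hq0)
  have d4 := thetaD_mul_q hQ0 hQ (pow_ne_zero 5 hq0)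
  rw [← pow_add] at h4 d4
  have t0 : tri 0 = 0 := rfl
  have t1 : tri 1 = 0 := rfl
  have t2 : tri 2 = 1 := rfl
  have t3 : tri 3 = 3 := rfl
  have t4 : tri 4 = 6 := rfl
  have e : q ^ (6 : ℤ) = q ^ 6 := rfl
  have e3 : q ^ (3 : ℤ) = q ^ 3 := rfl
  rw [thetaD_dissect_aux hq0 hq hz, Fin.sum_univ_five]
  simp only [Fin.coe_ofNat_eq_mod, Nat.reduceMod,
    Nat.cast_ofNat, Nat.cast_zero, Nat.cast_one, t0, t1, t2, t3, t4, e, e3, zpow_zero, zpow_one,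
    Nat.reduceMul, Nat.reduceAdd, h1, h2, h3, d1, d2] at h4 d4 ⊢
  linear_combination z ^ 4 * q * (4 * h4 + 5 * d4)

end

lemma pow_five_eq_one {ζ : ℂ} (hζ : 1 + ζ + ζ ^ 2 + ζ ^ 3 + ζ ^ 4 = 0) : ζ ^ 5 = 1 := by
  linear_combination (ζ - 1) * hζ

lemma sq_cyclotomic {ζ : ℂ} (hζ : 1 + ζ + ζ ^ 2 + ζ ^ 3 + ζ ^ 4 = 0) :
    1 + ζ ^ 2 + (ζ ^ 2) ^ 2 + (ζ ^ 2) ^ 3 + (ζ ^ 2) ^ 4 = 0 := by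
  linear_combination (1 - ζ + ζ ^ 2 - ζ ^ 3 + ζ ^ 4) * hζ

lemma cyclotomic_mul_ne_zero {ζ : ℂ} (hζ : 1 + ζ + ζ ^ 2 + ζ ^ 3 + ζ ^ 4 = 0) :
    (1 - ζ) * (1 - ζ ^ 2) ≠ 0 := by
  intro h
  have : (1 : ℂ) = 0 := by
    linear_combination -(-1 + ζ + 1 / 5 * ζ ^ 2 - 3 / 5 * ζ ^ 3 + 1 / 5 * ζ ^ 4) * hζ +
      1 / 5 * ζ ^ 2 * ((1 - ζ) * (1 - ζ ^ 2)) * h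
  exact one_ne_zero this

lemma quotient_eq_of_mul_eq {ζ P J T T' N : ℂ} (hζ : 1 + ζ + ζ ^ 2 + ζ ^ 3 + ζ ^ 4 = 0)
    (hP : P ≠ 0) (hJ : J ≠ 0) (h : T * T' = (1 - ζ) * (1 - ζ ^ 2) * (P * J)) :
    P ^ 2 * N / T ^ 2 = 1 / 5 * ζ ^ 2 * (N * T' ^ 2) / J ^ 2 := by
  have hc := cyclotomic_mul_ne_zero hζ
  have h0 : T * T' ≠ 0 := by rw [h]; exact mul_ne_zero hc (mul_ne_zero hP hJ)
  have hT := left_ne_zero_of_mul h0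
  have hr : 1 / 5 * ζ ^ 2 * ((1 - ζ) * (1 - ζ ^ 2)) ^ 2 = 1 := by
    linear_combination (-1 + ζ + 1 / 5 * ζ ^ 2 - 3 / 5 * ζ ^ 3 + 1 / 5 * ζ ^ 4) * hζ
  rw [div_eq_div_iff (pow_ne_zero 2 hT) (pow_ne_zero 2 hJ)]
  calc P ^ 2 * N * J ^ 2
      = 1 / 5 * ζ ^ 2 * ((1 - ζ) * (1 - ζ ^ 2)) ^ 2 * (P ^ 2 * N * J ^ 2) := by rw [hr, one_mul]
    _ = 1 / 5 * ζ ^ 2 * N * ((1 - ζ) * (1 - ζ ^ 2) * (P * J)) ^ 2 := by ring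
    _ = _ := by rw [← h]; ring

/-- The `5`-dissection of the odd part of the crank series at a primitive fifth root of unity. -/
lemma exists_crank_odd_part_dissect {ζ y : ℂ} (hζ : 1 + ζ + ζ ^ 2 + ζ ^ 3 + ζ ^ 4 = 0)
    (hy0 : y ≠ 0) (hy : ‖y‖ < 1) : ∃ c₀ c₁ c₃ c₄ c₅ : ℂ, ∀ x : ℂ, x ^ 5 = y →
    poch x x ^ 2 * ((1 - ζ) * thetaD x ζ + ζ * theta x ζ) / theta x ζ ^ 2 =
      c₀ + c₁ * x + (theta (y ^ 5) y ^ 2 * thetaD (y ^ 5) (y ^ 2) *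
        (2 + 4 * ζ + ζ ^ 2 + 3 * ζ ^ 3) - theta (y ^ 5) (y ^ 2) * theta (y ^ 5) y *
        thetaD (y ^ 5) y * (2 + 4 * ζ - 4 * ζ ^ 2 + 8 * ζ ^ 3) -
        theta (y ^ 5) (y ^ 2) * theta (y ^ 5) y ^ 2 * (2 * ζ ^ 2 - 2 * ζ ^ 3)) / poch y y ^ 2 * x ^ 2
        + c₃ * x ^ 3 + c₄ * x ^ 4 + c₅ * x ^ 5 := by
  obtain ⟨A, hA⟩ : ∃ A, A = theta (y ^ 5) (y ^ 2) := ⟨_, rfl⟩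
  obtain ⟨B, hB⟩ : ∃ B, B = theta (y ^ 5) y := ⟨_, rfl⟩
  obtain ⟨a, ha⟩ : ∃ a, a = thetaD (y ^ 5) (y ^ 2) := ⟨_, rfl⟩
  obtain ⟨b, hb⟩ : ∃ b, b = thetaD (y ^ 5) y := ⟨_, rfl⟩
  obtain ⟨e, he⟩ : ∃ e, e = thetaD (y ^ 5) (y ^ 5) := ⟨_, rfl⟩
  obtain ⟨J, hJ⟩ : ∃ J, J = poch y y := ⟨_, rfl⟩
  have hJ0 : J ≠ 0 := hJ ▸ poch_ne_zero_of_norm_lt_one hy hy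
  rw [← hA, ← hB, ← ha, ← hb, ← hJ]
  obtain ⟨u, hu⟩ : ∃ u, u = 1 - ζ ^ 2 := ⟨_, rfl⟩
  obtain ⟨v, hv⟩ : ∃ v, v = ζ ^ 4 - ζ ^ 3 := ⟨_, rfl⟩
  obtain ⟨n₀, hn₀⟩ : ∃ n₀, n₀ = 5 * a * (1 - ζ ^ 2) := ⟨_, rfl⟩
  obtain ⟨n₁, hn₁⟩ : ∃ n₁, n₁ = B * (2 * ζ ^ 2 - ζ ^ 3 + ζ ^ 4 - 2) -
    5 * b * (ζ ^ 2 - ζ ^ 3 + ζ ^ 4 - 1) := ⟨_, rfl⟩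
  obtain ⟨n₃, hn₃⟩ : ∃ n₃, n₃ = -5 * ζ ^ 3 * (1 - ζ) * e := ⟨_, rfl⟩
  have hζ5 := pow_five_eq_one hζ
  have hc₂ : 1 / 5 * ζ ^ 2 * (n₀ * (v ^ 2 * B ^ 2) + n₁ * (2 * u * v * A * B)) =
      B ^ 2 * a * (2 + 4 * ζ + ζ ^ 2 + 3 * ζ ^ 3) - A * B * b * (2 + 4 * ζ - 4 * ζ ^ 2 + 8 * ζ ^ 3) -
        A * B ^ 2 * (2 * ζ ^ 2 - 2 * ζ ^ 3) := by
    rw [hn₀, hn₁, hu, hv]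
    linear_combination (2 * A * B * b + 2 * A * B * b * ζ + (-8) * A * B * b * ζ ^ 2 +
      12 * A * B * b * ζ ^ 3 + (-8) * A * B * b * ζ ^ 4 + 6 * A * B * b * ζ ^ 6 +
      (-6) * A * B * b * ζ ^ 7 + 2 * A * B * b * ζ ^ 8 + 2 * A * B ^ 2 * ζ ^ 2 +
      (-4) * A * B ^ 2 * ζ ^ 3 + 2 * A * B ^ 2 * ζ ^ 4 + (4/5) * A * B ^ 2 * ζ ^ 5 +
      (-8/5) * A * B ^ 2 * ζ ^ 6 + (6/5) * A * B ^ 2 * ζ ^ 7 + (-2/5) * A * B ^ 2 * ζ ^ 8 +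
      (-2) * B ^ 2 * a + (-2) * B ^ 2 * a * ζ + 3 * B ^ 2 * a * ζ ^ 2 + (-2) * B ^ 2 * a * ζ ^ 3 +
      3 * B ^ 2 * a * ζ ^ 4 + (-2) * B ^ 2 * a * ζ ^ 5 + (-2) * B ^ 2 * a * ζ ^ 6 +
      3 * B ^ 2 * a * ζ ^ 7 + (-1) * B ^ 2 * a * ζ ^ 8) * hζ
  rw [← hc₂]
  obtain ⟨r, hr⟩ : ∃ r, r = 1 / 5 * ζ ^ 2 / J ^ 2 := ⟨_, rfl⟩
  refine ⟨r * (n₀ * (u ^ 2 * A ^ 2)), r * (n₀ * (2 * u * v * A * B) + n₁ * (u ^ 2 * A ^ 2)),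
    r * (n₁ * (v ^ 2 * B ^ 2) + n₃ * (u ^ 2 * A ^ 2)), r * (n₃ * (2 * u * v * A * B)),
    r * (n₃ * (v ^ 2 * B ^ 2)), fun x hx => ?_⟩
  have hx0 : x ≠ 0 := by rintro rfl; exact hy0 (by rw [← hx]; norm_num)
  have hx1 : ‖x‖ < 1 := by
    rw [← hx, norm_pow] at hy
    exact (pow_lt_one_iff_of_nonneg (norm_nonneg x) (by norm_num)).mp hy
  have h25 : x ^ 25 = y ^ 5 := by rw [← hx]; ring
  have h10 : x ^ 10 = y ^ 2 := by rw [← hx]; ring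
  have hT' : theta x (ζ ^ 2) = u * A + x * v * B := by
    rw [theta_dissect hx0 hx1 (by rw [← pow_mul, mul_comm, pow_mul, hζ5, one_pow]), h25, h10, hx,
      ← hA, ← hB, hu, hv]
    linear_combination (-x * B * ζ ^ 3) * hζ5
  have hN : (1 - ζ) * thetaD x ζ + ζ * theta x ζ = n₀ + n₁ * x + n₃ * x ^ 3 := by
    rw [theta_dissect hx0 hx1 hζ5, thetaD_dissect hx0 hx1 hζ5, h25, h10, hx, ← hA, ← hB, ← ha,
      ← hb, ← he, hn₀, hn₁, hn₃]
    linear_combination x * (5 * b - 2 * B) * hζ5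
  rw [quotient_eq_of_mul_eq hζ (poch_ne_zero_of_norm_lt_one hx1 hx1) hJ0
    ((theta_mul_theta_sq hx0 hx1 hζ).trans (by rw [hx, ← hJ])), hN, hT',
    show 1 / 5 * ζ ^ 2 * ((n₀ + n₁ * x + n₃ * x ^ 3) * (u * A + x * v * B) ^ 2) / J ^ 2 =
      r * ((n₀ + n₁ * x + n₃ * x ^ 3) * (u * A + x * v * B) ^ 2) by rw [hr]; ring,
    show 1 / 5 * ζ ^ 2 * (n₀ * (v ^ 2 * B ^ 2) + n₁ * (2 * u * v * A * B)) / J ^ 2 =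
      r * (n₀ * (v ^ 2 * B ^ 2) + n₁ * (2 * u * v * A * B)) by rw [hr]; ring]
  ring

/-- A weighted combination over the conjugates of `ζ` of the odd parts of the crank series. -/
noncomputable def crankDiff (ζ x : ℂ) : ℂ :=
  1 / 5 * ((ζ ^ 4 - ζ) *
      (poch x x ^ 2 * ((1 - ζ) * thetaD x ζ + ζ * theta x ζ) / theta x ζ ^ 2) +
    (ζ ^ 3 - ζ ^ 2) *
      (poch x x ^ 2 * ((1 - ζ ^ 2) * thetaD x (ζ ^ 2) + ζ ^ 2 * theta x (ζ ^ 2)) /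
        theta x (ζ ^ 2) ^ 2))

lemma exists_crankDiff_dissect {ζ y : ℂ} (hζ : 1 + ζ + ζ ^ 2 + ζ ^ 3 + ζ ^ 4 = 0)
    (hy0 : y ≠ 0) (hy : ‖y‖ < 1) : ∃ c₀ c₁ c₃ c₄ c₅ : ℂ, ∀ x : ℂ, x ^ 5 = y →
    crankDiff ζ x = c₀ + c₁ * x + (2 * (theta (y ^ 5) y ^ 2 * thetaD (y ^ 5) (y ^ 2) -
        theta (y ^ 5) (y ^ 2) * theta (y ^ 5) y * thetaD (y ^ 5) y) / poch y y ^ 2) * x ^ 2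
        + c₃ * x ^ 3 + c₄ * x ^ 4 + c₅ * x ^ 5 := by
  obtain ⟨c₀, c₁, c₃, c₄, c₅, h⟩ := exists_crank_odd_part_dissect hζ hy0 hy
  obtain ⟨d₀, d₁, d₃, d₄, d₅, h'⟩ := exists_crank_odd_part_dissect (sq_cyclotomic hζ) hy0 hy
  refine ⟨1 / 5 * ((ζ ^ 4 - ζ) * c₀ + (ζ ^ 3 - ζ ^ 2) * d₀),
    1 / 5 * ((ζ ^ 4 - ζ) * c₁ + (ζ ^ 3 - ζ ^ 2) * d₁),
    1 / 5 * ((ζ ^ 4 - ζ) * c₃ + (ζ ^ 3 - ζ ^ 2) * d₃),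
    1 / 5 * ((ζ ^ 4 - ζ) * c₄ + (ζ ^ 3 - ζ ^ 2) * d₄),
    1 / 5 * ((ζ ^ 4 - ζ) * c₅ + (ζ ^ 3 - ζ ^ 2) * d₅), fun x hx => ?_⟩
  rw [crankDiff, h x hx, h' x hx]
  generalize theta (y ^ 5) (y ^ 2) = A
  generalize theta (y ^ 5) y = B
  generalize thetaD (y ^ 5) (y ^ 2) = a
  generalize thetaD (y ^ 5) y = b
  generalize poch y y = J
  linear_combination x ^ 2 / J ^ 2 * (2 * A * B * b + (-8/5) * A * B * b * ζ +
    (4/5) * A * B * b * ζ ^ 2 + (-12/5) * A * B * b * ζ ^ 3 + (16/5) * A * B * b * ζ ^ 4 +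
    (-8/5) * A * B * b * ζ ^ 5 + (2/5) * A * B ^ 2 * ζ ^ 3 + (-4/5) * A * B ^ 2 * ζ ^ 4 +
    (2/5) * A * B ^ 2 * ζ ^ 5 + (-2) * B ^ 2 * a + (8/5) * B ^ 2 * a * ζ +
    (-4/5) * B ^ 2 * a * ζ ^ 2 + (7/5) * B ^ 2 * a * ζ ^ 3 + (-6/5) * B ^ 2 * a * ζ ^ 4 +
    (3/5) * B ^ 2 * a * ζ ^ 5) * hζ

lemma zpow_eq_pow_emod_five {ζ : ℂ} (h5 : ζ ^ 5 = 1) (c : ℤ) : ζ ^ c = ζ ^ (c % 5).toNat := by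
  have hζ0 : ζ ≠ 0 := by rintro rfl; norm_num at h5
  rw [← zpow_natCast, Int.toNat_of_nonneg (Int.emod_nonneg c (by norm_num))]
  conv_lhs => rw [← Int.emod_add_mul_ediv c 5]
  rw [zpow_add₀ hζ0, zpow_mul, show ζ ^ (5 : ℤ) = 1 by exact_mod_cast h5, one_zpow, mul_one]

lemma character_orthogonality {ζ : ℂ} (hζ : 1 + ζ + ζ ^ 2 + ζ ^ 3 + ζ ^ 4 = 0) (c : ℤ) :
    1 / 5 * ((ζ ^ 4 - ζ) * (ζ ^ c - ζ⁻¹ ^ c) +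
      (ζ ^ 3 - ζ ^ 2) * ((ζ ^ 2) ^ c - (ζ ^ 2)⁻¹ ^ c)) =
    (if c % 5 = 1 then 1 else 0) - (if c % 5 = 4 then 1 else 0) := by
  have h5 := pow_five_eq_one hζ
  have hi : ζ⁻¹ = ζ ^ 4 := inv_eq_of_mul_eq_one_right (by linear_combination h5)
  have h5' {k : ℕ} : (ζ ^ k) ^ 5 = 1 := by rw [← pow_mul, mul_comm, pow_mul, h5, one_pow]
  rw [← inv_pow, hi, ← pow_mul, zpow_eq_pow_emod_five h5, zpow_eq_pow_emod_five h5',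
    zpow_eq_pow_emod_five h5', zpow_eq_pow_emod_five h5']
  have h0 := Int.emod_nonneg c (show (5 : ℤ) ≠ 0 by norm_num)
  have h1 := Int.emod_lt_of_pos c (show (0 : ℤ) < 5 by norm_num)
  have red (k : ℕ) : ζ ^ (k + 5) = ζ ^ k := by rw [pow_add, h5, mul_one]
  generalize c % 5 = r at h0 h1
  interval_cases r <;> simp [← pow_mul, red]
  · linear_combination -(1 / 5) * hζ - 1 / 5 * (ζ ^ 3 + ζ - 4) * h5
  · ring
  · ring
  · linear_combination 1 / 5 * hζ + 1 / 5 * (ζ ^ 3 + ζ - 4) * h5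

lemma hasSum_crankDiff {ζ x : ℂ} (hζ : 1 + ζ + ζ ^ 2 + ζ ^ 3 + ζ ^ 4 = 0) (hx0 : x ≠ 0)
    (hx : ‖x‖ < 1) :
    HasSum (fun n : ℕ => ((Mw 1 5 n - Mw 4 5 n : ℤ) : ℂ) * x ^ n) (crankDiff ζ x) := by
  have h5 := pow_five_eq_one hζ
  have hn : ‖ζ‖ = 1 := Complex.norm_eq_one_of_pow_eq_one h5 (by norm_num)
  have hn2 : ‖ζ ^ 2‖ = 1 := by rw [norm_pow, hn, one_pow]
  have hc := cyclotomic_mul_ne_zero hζ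
  have h1 := (hasSum_omega_crank hx hn).sub (hasSum_omega_crank hx (z := ζ⁻¹) (by simp [hn]))
  have h2 := (hasSum_omega_crank hx hn2).sub
    (hasSum_omega_crank hx (z := (ζ ^ 2)⁻¹) (by rw [norm_inv, hn2, inv_one]))
  rw [crank_odd_part_eq hx0 hx hn (fun h => hc (by rw [h]; ring))] at h1
  rw [crank_odd_part_eq hx0 hx hn2 (fun h => hc (by rw [h]; ring))] at h2
  refine hasSum_of_eq (((h1.mul_left (ζ ^ 4 - ζ)).add (h2.mul_left (ζ ^ 3 - ζ ^ 2))).mul_left (1 / 5))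
    (fun n => ?_) rfl
  simp only [← sub_mul, ← mul_assoc, ← add_mul]
  congr 1
  rw [Mw, Mw, ← Finset.sum_sub_distrib, ← Finset.sum_sub_distrib, ← Finset.sum_sub_distrib,
    Finset.mul_sum, Finset.mul_sum, ← Finset.sum_add_distrib, Finset.mul_sum, Int.cast_sum]
  refine Finset.sum_congr rfl fun π _ => ?_
  have key := character_orthogonality hζ (crank π)
  calc _ = (omegaOnes π : ℂ) * ((if crank π % 5 = 1 then 1 else 0) -
        (if crank π % 5 = 4 then 1 else 0)) := by
        by_cases h1 : crank π % 5 = 1 <;> by_cases h4 : crank π % 5 = 4 <;> simp [h1, h4]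
    _ = _ := by rw [← key]; ring

lemma sum_pow_cyclotomic {ζ : ℂ} (hζ : 1 + ζ + ζ ^ 2 + ζ ^ 3 + ζ ^ 4 = 0) (n : ℕ) :
    1 / 5 * ∑ i ∈ Finset.range 5, ζ ^ (3 * i) * (ζ ^ i) ^ n = if n % 5 = 2 then 1 else 0 := by
  have h5 := pow_five_eq_one hζ
  have h (i : ℕ) : (ζ ^ i) ^ n = (ζ ^ i) ^ (n % 5) := by
    have h5' : (ζ ^ i) ^ 5 = 1 := by rw [← pow_mul, mul_comm, pow_mul, h5, one_pow]
    conv_lhs => rw [← Nat.mod_add_div n 5, pow_add, pow_mul, h5', one_pow, mul_one]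
  simp only [h]
  have h1 := Nat.mod_lt n (show 5 > 0 by norm_num)
  have red (k : ℕ) : ζ ^ (k + 5) = ζ ^ k := by rw [pow_add, h5, mul_one]
  generalize n % 5 = r at h1
  interval_cases r <;> simp [Finset.sum_range_succ, ← pow_mul, ← pow_add, red] <;>
    first | linear_combination hζ | norm_num

lemma hasSum_section {s : ℕ → ℂ} {p c₀ c₁ c₂ c₃ c₄ c₅ : ℂ} (hp : p ≠ 0)
    (h : ∀ x : ℂ, x ^ 5 = p ^ 5 → HasSum (fun n => s n * x ^ n)
      (c₀ + c₁ * x + c₂ * x ^ 2 + c₃ * x ^ 3 + c₄ * x ^ 4 + c₅ * x ^ 5))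
    {ζ : ℂ} (hζ : 1 + ζ + ζ ^ 2 + ζ ^ 3 + ζ ^ 4 = 0) :
    HasSum (fun n => s (5 * n + 2) * (p ^ 5) ^ n) c₂ := by
  have h5 := pow_five_eq_one hζ
  have key : HasSum (fun n => if n % 5 = 2 then s n * p ^ n else 0) (c₂ * p ^ 2) := by
    have hsum := (hasSum_sum (s := Finset.range 5) fun i _ =>
      (h (ζ ^ i * p) (by rw [mul_pow, ← pow_mul, mul_comm i, pow_mul, h5, one_pow, one_mul])).mul_left
        (ζ ^ (3 * i))).mul_left (1 / 5)
    refine hasSum_of_eq hsum (fun n => ?_) (Eq.symm ?_)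
    · calc _ = s n * p ^ n * (if n % 5 = 2 then 1 else 0) := by split_ifs <;> simp
        _ = _ := by
          rw [← sum_pow_cyclotomic hζ, Finset.mul_sum, Finset.mul_sum, Finset.mul_sum]
          refine Finset.sum_congr rfl fun i _ => ?_
          rw [mul_pow]
          ring
    · have e := sum_pow_cyclotomic hζ
      calc _ = c₀ * (1 / 5 * ∑ i ∈ Finset.range 5, ζ ^ (3 * i) * (ζ ^ i) ^ 0)
            + c₁ * p * (1 / 5 * ∑ i ∈ Finset.range 5, ζ ^ (3 * i) * (ζ ^ i) ^ 1)
            + c₂ * p ^ 2 * (1 / 5 * ∑ i ∈ Finset.range 5, ζ ^ (3 * i) * (ζ ^ i) ^ 2)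
            + c₃ * p ^ 3 * (1 / 5 * ∑ i ∈ Finset.range 5, ζ ^ (3 * i) * (ζ ^ i) ^ 3)
            + c₄ * p ^ 4 * (1 / 5 * ∑ i ∈ Finset.range 5, ζ ^ (3 * i) * (ζ ^ i) ^ 4)
            + c₅ * p ^ 5 * (1 / 5 * ∑ i ∈ Finset.range 5, ζ ^ (3 * i) * (ζ ^ i) ^ 5) := ?_
        _ = c₂ * p ^ 2 := by simp only [e]; norm_num
      simp only [Finset.sum_range_succ, Finset.sum_range_zero]
      ring
  have hinj : Function.Injective fun n : ℕ => 5 * n + 2 := fun m n hmn => by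
    simp only at hmn; omega
  have h' := (hinj.hasSum_iff fun n hn => by
    rw [if_neg]
    intro hn'
    exact hn ⟨n / 5, by simp only; omega⟩).mpr key
  refine hasSum_of_eq (h'.mul_left (p ^ 2)⁻¹) (fun n => ?_) ?_
  · simp only [Function.comp_apply, Nat.mul_add_mod, if_true, Nat.reduceMod]
    field_simp
    ring
  · field_simp

lemma poch_five_dissect {q : ℂ} (hq : ‖q‖ < 1) : poch q q =
    poch q (q ^ 5) * poch (q ^ 2) (q ^ 5) * poch (q ^ 3) (q ^ 5) * poch (q ^ 4) (q ^ 5) *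
      poch (q ^ 5) (q ^ 5) := by
  have hq5 : ‖q ^ 5‖ < 1 := by
    rw [norm_pow]; exact pow_lt_one₀ (norm_nonneg q) hq (by norm_num)
  have h1 := (tendsto_prod_poch hq q).comp
    (tendsto_id.const_mul_atTop' (show 0 < 5 by norm_num))
  have h2 := ((((tendsto_prod_poch hq5 q).mul (tendsto_prod_poch hq5 (q ^ 2))).mul
    (tendsto_prod_poch hq5 (q ^ 3))).mul (tendsto_prod_poch hq5 (q ^ 4))).mul
    (tendsto_prod_poch hq5 (q ^ 5))
  refine tendsto_nhds_unique (h1.congr fun n => ?_) h2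
  simp only [Function.comp_apply, id]
  induction n with
  | zero => simp
  | succ n ih =>
    rw [show 5 * (n + 1) = 5 * n + 1 + 1 + 1 + 1 + 1 by ring]
    simp only [Finset.prod_range_succ, ih]
    ring

/-- Linear relations between the Euler derivatives of the two theta functions of nome `q⁵`. -/
theorem thetaD_relations {q : ℂ} (hq0 : q ≠ 0) (hq : ‖q‖ < 1) :
    -poch (q ^ 5) (q ^ 5) ^ 3 * theta (q ^ 5) (q ^ 2) ^ 3 =
      3 * theta (q ^ 5) q ^ 2 * thetaD (q ^ 5) q * theta (q ^ 5) (q ^ 2) +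
        theta (q ^ 5) q ^ 3 * thetaD (q ^ 5) (q ^ 2) - theta (q ^ 5) q ^ 3 * theta (q ^ 5) (q ^ 2) ∧
    -q * poch (q ^ 5) (q ^ 5) ^ 3 * theta (q ^ 5) q ^ 3 =
      -(3 * theta (q ^ 5) (q ^ 2) ^ 2 * thetaD (q ^ 5) (q ^ 2) * theta (q ^ 5) q) +
        theta (q ^ 5) (q ^ 2) ^ 3 * thetaD (q ^ 5) q := by
  have hq5 : ‖q ^ 5‖ < 1 := by
    rw [norm_pow]; exact pow_lt_one₀ (norm_nonneg q) hq (by norm_num)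
  have hQ0 : q ^ 5 ≠ 0 := pow_ne_zero 5 hq0
  have d3 : q ^ 5 / q ^ 2 = q ^ 3 := pow_div_pow_eq hq0 2 3
  have d4 : q ^ 5 / q = q ^ 4 := by rw [← pow_div_pow_eq hq0 1 4, pow_one]
  have t3 := theta_reflect hQ0 (q ^ 2)
  have t4 := theta_reflect hQ0 q
  have s3 := thetaD_reflect hQ0 hq5 (pow_ne_zero 2 hq0)
  have t6 := theta_mul_q hQ0 hq0
  have s6 := thetaD_mul_q hQ0 hq5 hq0
  rw [d3] at t3 s3
  rw [d4] at t4
  rw [show q ^ 5 * q = (q ^ 2) ^ 3 by ring] at t6 s6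
  have h1 := thetaD_cubic hQ0 hq5 hq0
  have h2 := thetaD_cubic hQ0 hq5 (pow_ne_zero 2 hq0)
  rw [show (q ^ 2) ^ 2 = q ^ 4 by ring, t4] at h2
  rw [t3, s3] at h1
  generalize thetaD (q ^ 5) ((q ^ 2) ^ 3) = α at *
  generalize theta (q ^ 5) ((q ^ 2) ^ 3) = β at *
  generalize thetaD (q ^ 5) (q ^ 2) = A' at *
  generalize theta (q ^ 5) (q ^ 2) = A at *
  generalize thetaD (q ^ 5) q = B' at *
  generalize theta (q ^ 5) q = B at *
  refine ⟨by linear_combination h1, ?_⟩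
  linear_combination q * h2 + (3 * A ^ 2 * A' - A ^ 3) * t6 - A ^ 3 * s6

lemma log_thetaD_combination {X Y J q a b : ℂ} (hX : X ≠ 0) (hY : Y ≠ 0) (hJ : J ≠ 0)
    (h1 : -J ^ 3 * (Y * J) ^ 3 =
      3 * (X * J) ^ 2 * b * (Y * J) + (X * J) ^ 3 * a - (X * J) ^ 3 * (Y * J))
    (h2 : -q * J ^ 3 * (X * J) ^ 3 = -(3 * (Y * J) ^ 2 * a * (X * J)) + (Y * J) ^ 3 * b) :
    2 * ((X * J) ^ 2 * a - Y * J * (X * J) * b) / (X * Y * J) ^ 2 =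
      4 * q / 5 * X ^ 2 * J ^ 3 / Y ^ 4 + 2 / 5 * Y * J ^ 3 / X ^ 3 - 2 / 5 * J / Y := by
  have e1 : -J ^ 3 * Y ^ 3 = 3 * X ^ 2 * b * Y + X ^ 3 * a - X ^ 3 * Y * J :=
    mul_left_cancel₀ (pow_ne_zero 3 hJ) (by linear_combination h1)
  have e2 : -q * J ^ 3 * X ^ 3 = -(3 * Y ^ 2 * a * X) + Y ^ 3 * b :=
    mul_left_cancel₀ (pow_ne_zero 3 hJ) (by linear_combination h2)
  have t1 : 4 * q / 5 * X ^ 2 * J ^ 3 / Y ^ 4 = 4 / 5 * (3 * X * a - Y * b) / (X * Y ^ 2) := by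
    rw [div_eq_div_iff (pow_ne_zero 4 hY) (by positivity)]
    linear_combination -(4 / 5 * Y ^ 2) * e2
  have t2 : 2 / 5 * Y * J ^ 3 / X ^ 3 =
      2 / 5 * (X * Y * J - 3 * Y * b - X * a) / (X * Y ^ 2) := by
    rw [div_eq_div_iff (pow_ne_zero 3 hX) (by positivity)]
    linear_combination -(2 / 5 * X) * e1
  rw [t1, t2]
  field_simp
  ring

theorem hasSum_Mw_section {q : ℂ} (hq0 : q ≠ 0) (hq : ‖q‖ < 1) :
    HasSum (fun n : ℕ => ((Mw 1 5 (5 * n + 2) - Mw 4 5 (5 * n + 2) : ℤ) : ℂ) * q ^ n)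
      (2 * (theta (q ^ 5) q ^ 2 * thetaD (q ^ 5) (q ^ 2) -
        theta (q ^ 5) (q ^ 2) * theta (q ^ 5) q * thetaD (q ^ 5) q) / poch q q ^ 2) := by
  have hprim := Complex.isPrimitiveRoot_exp 5 (by norm_num)
  generalize Complex.exp (2 * Real.pi * Complex.I / (5 : ℕ)) = ζ at hprim
  have hζ : 1 + ζ + ζ ^ 2 + ζ ^ 3 + ζ ^ 4 = 0 := by
    simpa [Finset.sum_range_succ] using hprim.geom_sum_eq_zero (by norm_num)
  obtain ⟨p, rfl⟩ : ∃ p : ℂ, p ^ 5 = q := IsAlgClosed.exists_pow_nat_eq q (by norm_num)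
  have hp0 : p ≠ 0 := by rintro rfl; norm_num at hq0
  have hp : ‖p‖ < 1 := by
    rw [norm_pow] at hq
    exact (pow_lt_one_iff_of_nonneg (norm_nonneg p) (by norm_num)).mp hq
  obtain ⟨c₀, c₁, c₃, c₄, c₅, h⟩ := exists_crankDiff_dissect hζ hq0 hq
  refine hasSum_section hp0 (fun x hx => ?_) hζ
    (s := fun n => ((Mw 1 5 n - Mw 4 5 n : ℤ) : ℂ))
    (c₀ := c₀) (c₁ := c₁) (c₃ := c₃) (c₄ := c₄) (c₅ := c₅)
  have hx0 : x ≠ 0 := by rintro rfl; exact hq0 (by rw [← hx]; norm_num)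
  have hx1 : ‖x‖ < 1 := by
    rw [← hx, norm_pow] at hq
    exact (pow_lt_one_iff_of_nonneg (norm_nonneg x) (by norm_num)).mp hq
  rw [← h x hx]
  exact hasSum_crankDiff hζ hx0 hx1

lemma parts_eq_of_omegaOnes_ne_zero (π : (2 : ℕ).Partition) (h : omegaOnes π ≠ 0) :
    π.parts = {1, 1} := by
  obtain ⟨t, ht⟩ := Multiset.exists_cons_of_mem (Multiset.count_ne_zero.mp h)
  have hsum := π.parts_sum
  have hpos : ∀ i ∈ π.parts, 0 < i := fun i => π.parts_pos
  rw [ht] at hsum hpos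
  rcases t.empty_or_exists_mem with rfl | ⟨a, ha⟩
  · simp at hsum
  obtain ⟨s, rfl⟩ := Multiset.exists_cons_of_mem ha
  have ha0 := hpos a (by simp)
  simp only [Multiset.sum_cons] at hsum
  rcases s.empty_or_exists_mem with rfl | ⟨b, hb⟩
  · obtain rfl : a = 1 := by simp at hsum; omega
    exact ht
  · have hb0 := hpos b (by simp [hb])
    have hb1 := Multiset.single_le_sum (fun _ _ => Nat.zero_le _) b hb
    omega

lemma Mw_two {m : ℕ} (hm : m % 5 ≠ 3) : Mw m 5 2 = 0 := by
  refine Finset.sum_eq_zero fun π _ => ?_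
  by_cases h : omegaOnes π = 0
  · simp [h]
  have hp := parts_eq_of_omegaOnes_ne_zero π h
  have hc : crank π = -2 := by simp [crank, muParts, omegaOnes, hp]
  rw [if_neg]
  rw [hc]
  push_cast
  omega

end

/-- Identity (4.9): for `|q| < 1`,
`∑_{n≥0} (Mω(1,5,5n+2) − Mω(4,5,5n+2)) qⁿ
  = (4q/5)(q,q⁴;q⁵)_∞²(q⁵;q⁵)_∞³/(q²,q³;q⁵)_∞⁴
    + (2/5)(q²,q³;q⁵)_∞(q⁵;q⁵)_∞³/(q,q⁴;q⁵)_∞³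
    − (2/5)(q⁵;q⁵)_∞/(q²,q³;q⁵)_∞`. -/
theorem statement_19 (q : ℂ) (hq : ‖q‖ < 1) :
    ∑' n : ℕ, ((Mw 1 5 (5 * n + 2) - Mw 4 5 (5 * n + 2) : ℤ) : ℂ) * q ^ n
      = 4 * q / 5 * (poch q (q ^ 5) * poch (q ^ 4) (q ^ 5)) ^ 2
          * (poch (q ^ 5) (q ^ 5)) ^ 3
          / (poch (q ^ 2) (q ^ 5) * poch (q ^ 3) (q ^ 5)) ^ 4
        + 2 / 5 * (poch (q ^ 2) (q ^ 5) * poch (q ^ 3) (q ^ 5))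
          * (poch (q ^ 5) (q ^ 5)) ^ 3
          / (poch q (q ^ 5) * poch (q ^ 4) (q ^ 5)) ^ 3
        - 2 / 5 * poch (q ^ 5) (q ^ 5)
          / (poch (q ^ 2) (q ^ 5) * poch (q ^ 3) (q ^ 5)) := by
  rcases eq_or_ne q 0 with rfl | hq0
  · rw [tsum_eq_single 0 fun n hn => by simp [hn]]
    simp [Mw_two, poch_zero]
  have hpow {k : ℕ} (hk : k ≠ 0) : ‖q ^ k‖ < 1 := by
    rw [norm_pow]; exact pow_lt_one₀ (norm_nonneg q) hq hk
  have hne {k : ℕ} (hk : k ≠ 0) : poch (q ^ k) (q ^ 5) ≠ 0 :=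
    poch_ne_zero_of_norm_lt_one (hpow (by norm_num)) (hpow hk)
  have hX : poch q (q ^ 5) * poch (q ^ 4) (q ^ 5) ≠ 0 :=
    mul_ne_zero (by simpa using hne one_ne_zero) (hne (by norm_num))
  have hY : poch (q ^ 2) (q ^ 5) * poch (q ^ 3) (q ^ 5) ≠ 0 :=
    mul_ne_zero (hne (by norm_num)) (hne (by norm_num))
  have hJ : poch (q ^ 5) (q ^ 5) ≠ 0 := hne (by norm_num)
  have hQ0 : q ^ 5 ≠ 0 := pow_ne_zero 5 hq0
  have hA := theta_eq_poch hQ0 (hpow (by norm_num)) (pow_ne_zero 2 hq0)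
  have hB := theta_eq_poch hQ0 (hpow (by norm_num)) hq0
  rw [pow_div_pow_eq hq0 2 3] at hA
  rw [show q ^ 5 / q = q ^ 4 by rw [← pow_div_pow_eq hq0 1 4, pow_one]] at hB
  obtain ⟨h1, h2⟩ := thetaD_relations hq0 hq
  rw [(hasSum_Mw_section hq0 hq).tsum_eq]
  rw [hA, hB] at h1 h2 ⊢
  rw [← log_thetaD_combination hX hY hJ h1 h2, poch_five_dissect hq]
  congr 2
  ring

end Beck
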